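/- For every positive integer d there exists N₀ such that for every integer N ≥ N₀ and every choice of signs ε_0, ε_1, …, ε_N ∈ {−1, 1}, the cosine polynomial f(θ) = Σ_{n=0}^N ε_n cos(nθ) has more than d distinct zeros in [0, 2π]. Equivalently, Z_{{±1}}(N) → ∞ as N → ∞, where Z_{{±1}}(N) is the minimum number of zeros in [0, 2π] of such a cosine polynomial of degree N. -/

import Mathlib

open Finset in
theorem sum_range_exp_eq_zero {n : ℕ} (hn : 0 < n) {j : ℤ} (hj : ¬ (n : ℤ) ∣ j) :
    ∑ m ∈ range n, Complex.exp (2 * Real.pi * Complex.I * (j * m / n)) = 0 := by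
  have hn' : (n : ℂ) ≠ 0 := by exact_mod_cast hn.ne'
  set x := Complex.exp (2 * Real.pi * Complex.I * (j / n)) with hx
  have hpow : ∀ m : ℕ, Complex.exp (2 * Real.pi * Complex.I * (j * m / n)) = x ^ m := by
    intro m
    rw [hx, ← Complex.exp_nat_mul]
    congr 1
    ring
  have hx1 : x ≠ 1 := by
    intro h
    rw [hx, Complex.exp_eq_one_iff] at h
    obtain ⟨k, hk⟩ := h
    have h2 : (2 * Real.pi * Complex.I : ℂ) ≠ 0 := Complex.two_pi_I_ne_zero
    have h3 : (j : ℂ) = n * k := by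
      have : (j / n : ℂ) = k := mul_left_cancel₀ h2 (by rw [hk]; ring)
      rw [← this]
      field_simp
    exact hj ⟨k, by exact_mod_cast h3⟩
  have hxn : x ^ n = 1 := by
    rw [← hpow, Complex.exp_eq_one_iff]
    exact ⟨j, by field_simp⟩
  simp_rw [hpow]
  rw [geom_sum_eq hx1, hxn]
  simp

open Finset in
theorem sum_range_exp_of_dvd {n : ℕ} (hn : 0 < n) {j : ℤ} (hj : (n : ℤ) ∣ j) :
    ∑ m ∈ range n, Complex.exp (2 * Real.pi * Complex.I * (j * m / n)) = n := by
  have hn' : (n : ℂ) ≠ 0 := by exact_mod_cast hn.ne'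
  obtain ⟨k, rfl⟩ := hj
  have : ∀ m ∈ range n,
      Complex.exp (2 * Real.pi * Complex.I * (((n * k : ℤ) : ℂ) * m / n)) = 1 := by
    intro m _
    rw [Complex.exp_eq_one_iff]
    exact ⟨k * m, by push_cast; field_simp⟩
  rw [sum_congr rfl this]
  simp

open Finset in
theorem sum_normSq_fourier {M : ℕ} (hM : 0 < M) (e : ℕ → ℝ)
    (he : ∀ r < M, e r = 1 ∨ e r = -1) :
    ∑ a ∈ range M, Complex.normSq
      (∑ r ∈ range M, (e r : ℂ) * Complex.exp (2 * Real.pi * Complex.I * (r * a / M)))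
      = (M : ℝ) ^ 2 := by
  have key : ∀ a : ℕ, (Complex.normSq
      (∑ r ∈ range M, (e r : ℂ) * Complex.exp (2 * Real.pi * Complex.I * (r * a / M))) : ℂ)
      = ∑ r ∈ range M, ∑ s ∈ range M, (e r : ℂ) * e s *
        Complex.exp (2 * Real.pi * Complex.I * (((r : ℤ) - (s : ℤ) : ℤ) * a / M)) := by
    intro a
    rw [Complex.normSq_eq_conj_mul_self, mul_comm, map_sum, sum_mul_sum]
    refine sum_congr rfl fun r _ => sum_congr rfl fun s _ => ?_
    rw [map_mul, Complex.conj_ofReal, ← Complex.exp_conj]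
    have : (starRingEnd ℂ) (2 * Real.pi * Complex.I * (s * a / M))
        = - (2 * Real.pi * Complex.I * (s * a / M)) := by
      simp [Complex.conj_ofNat]
    rw [this, mul_mul_mul_comm, ← Complex.exp_add]
    congr 2
    push_cast
    ring
  have : ((∑ a ∈ range M, Complex.normSq
      (∑ r ∈ range M, (e r : ℂ) * Complex.exp (2 * Real.pi * Complex.I * (r * a / M))) : ℝ) : ℂ)
      = (M : ℂ) ^ 2 := by
    rw [Complex.ofReal_sum]
    simp_rw [key]
    rw [sum_comm]
    have : ∀ r ∈ range M, ∑ a ∈ range M, ∑ s ∈ range M, (e r : ℂ) * e s *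
        Complex.exp (2 * Real.pi * Complex.I * (((r : ℤ) - (s : ℤ) : ℤ) * a / M)) = M := by
      intro r hr
      rw [sum_comm, sum_eq_single r]
      · rw [← mul_sum, sum_range_exp_of_dvd hM (by simp)]
        rcases he r (mem_range.1 hr) with h | h <;> simp [h]
      · intro s hs hsr
        rw [← mul_sum, sum_range_exp_eq_zero hM, mul_zero]
        intro hd
        have h1 := Int.eq_zero_of_abs_lt_dvd hd (by
          rw [abs_lt]; have := mem_range.1 hr; have := mem_range.1 hs; omega)
        omega
      · exact fun h => absurd hr h
    rw [sum_congr rfl this]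
    simp [sq]
  exact_mod_cast this

/-- The real part of `∑ k < L, c k * exp (i (k + 1/2) t)`. -/
noncomputable def halfSum (L : ℕ) (c : ℕ → ℂ) (t : ℝ) : ℝ :=
  (∑ k ∈ Finset.range L, c k * Complex.exp (((k : ℂ) + 1 / 2) * t * Complex.I)).re

open Finset in
theorem sum_halfSum_mul_halfSum {L : ℕ} (hL : 0 < L) (c : ℕ → ℂ) :
    ∑ m ∈ range (2 * L), halfSum L c (Real.pi * m / L) * halfSum L c (Real.pi * (m + 1 : ℕ) / L)
      = L * ∑ k ∈ range L, Complex.normSq (c k) * Real.cos ((k + 1 / 2) * (Real.pi / L)) := by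
  have hL' : (L : ℂ) ≠ 0 := by exact_mod_cast hL.ne'
  set E : ℕ → ℕ → ℂ := fun k m =>
    Complex.exp (((k : ℂ) + 1 / 2) * ((Real.pi * m / L : ℝ) : ℂ) * Complex.I) with hE
  have hG : ∀ m : ℕ, halfSum L c (Real.pi * m / L) = (∑ k ∈ range L, c k * E k m).re :=
    fun m => rfl
  have hre : ∀ A B : ℂ, A.re * B.re = ((A * B + A * (starRingEnd ℂ) B).re) / 2 := by
    intro A B
    simp
  have h1 : ∑ m ∈ range (2 * L), (∑ k ∈ range L, c k * E k m) * (∑ l ∈ range L, c l * E l (m + 1))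
      = 0 := by
    simp_rw [sum_mul_sum]
    rw [sum_comm]
    refine sum_eq_zero fun k hk => ?_
    rw [sum_comm]
    refine sum_eq_zero fun l hl => ?_
    have : ∀ m : ℕ, c k * E k m * (c l * E l (m + 1)) = c k * c l * E l 1 *
        Complex.exp (2 * Real.pi * Complex.I * (((k + l + 1 : ℕ) : ℤ) * m / (2 * L : ℕ))) := by
      intro m
      have : E k m * E l (m + 1) = E l 1 *
        Complex.exp (2 * Real.pi * Complex.I * (((k + l + 1 : ℕ) : ℤ) * m / (2 * L : ℕ))) := by
        simp only [hE]
        rw [← Complex.exp_add, ← Complex.exp_add]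
        congr 1
        push_cast
        field_simp
        ring
      linear_combination c k * c l * this
    simp_rw [this]
    rw [← mul_sum, sum_range_exp_eq_zero (by omega), mul_zero]
    intro hd
    have := Int.le_of_dvd (by omega) hd
    have := mem_range.1 hk
    have := mem_range.1 hl
    omega
  have h2 : ∑ m ∈ range (2 * L), (∑ k ∈ range L, c k * E k m) *
      (starRingEnd ℂ) (∑ l ∈ range L, c l * E l (m + 1))
      = ∑ k ∈ range L, (2 * L * Complex.normSq (c k)) * (starRingEnd ℂ) (E k 1) := by
    simp_rw [map_sum, sum_mul_sum]
    rw [sum_comm]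
    refine sum_congr rfl fun k hk => ?_
    have : ∀ l m : ℕ, c k * E k m * (starRingEnd ℂ) (c l * E l (m + 1)) =
        c k * (starRingEnd ℂ) (c l) * (starRingEnd ℂ) (E l 1) *
        Complex.exp (2 * Real.pi * Complex.I * (((k : ℤ) - (l : ℤ) : ℤ) * m / (2 * L : ℕ))) := by
      intro l m
      have : E k m * (starRingEnd ℂ) (E l (m + 1)) = (starRingEnd ℂ) (E l 1) *
        Complex.exp (2 * Real.pi * Complex.I * (((k : ℤ) - (l : ℤ) : ℤ) * m / (2 * L : ℕ))) := by
        simp only [hE]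
        rw [← Complex.exp_conj, ← Complex.exp_conj, ← Complex.exp_add, ← Complex.exp_add]
        congr 1
        simp [Complex.conj_ofNat]
        field_simp
        ring
      rw [map_mul]
      linear_combination c k * (starRingEnd ℂ) (c l) * this
    rw [sum_comm, sum_eq_single k]
    · simp_rw [this]
      rw [← mul_sum, sum_range_exp_of_dvd (by omega) (by simp), Complex.mul_conj]
      push_cast
      ring
    · intro l hl hlk
      simp_rw [this]
      rw [← mul_sum, sum_range_exp_eq_zero (by omega), mul_zero]
      intro hd
      have h1 := Int.eq_zero_of_abs_lt_dvd hd (by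
        rw [abs_lt]; have := mem_range.1 hk; have := mem_range.1 hl; omega)
      omega
    · exact fun h => absurd hk h
  simp_rw [hG, hre]
  rw [← sum_div, ← Complex.re_sum, sum_add_distrib, h1, h2, zero_add, Complex.re_sum, mul_sum,
    sum_div]
  refine sum_congr rfl fun k _ => ?_
  have : (E k 1).re = Real.cos ((k + 1 / 2) * (Real.pi / L)) := by
    rw [hE]
    have : ((k : ℂ) + 1 / 2) * ((Real.pi * (1 : ℕ) / L : ℝ) : ℂ) * Complex.I
      = (((k + 1 / 2) * (Real.pi / L) : ℝ) : ℂ) * Complex.I := by push_cast; ring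
    simp only [this]
    exact Complex.exp_ofReal_mul_I_re _
  have h3 : (2 * (L : ℂ) * Complex.normSq (c k)) = ((2 * L * Complex.normSq (c k) : ℝ) : ℂ) := by
    push_cast; rfl
  rw [h3, Complex.re_ofReal_mul, Complex.conj_re, this]
  ring

open Finset in
theorem sum_cos_half_eq_zero {L : ℕ} (hL : 0 < L) :
    ∑ k ∈ range L, Real.cos ((k + 1 / 2) * (Real.pi / L)) = 0 := by
  have hL' : (L : ℝ) ≠ 0 := by exact_mod_cast hL.ne'
  have h := sum_range_reflect (fun k : ℕ => Real.cos ((k + 1 / 2) * (Real.pi / L))) L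
  have h2 : ∀ k ∈ range L, Real.cos (((L - 1 - k : ℕ) + 1 / 2) * (Real.pi / L))
      = - Real.cos ((k + 1 / 2) * (Real.pi / L)) := by
    intro k hk
    have := mem_range.1 hk
    rw [← Real.cos_pi_sub]
    congr 1
    rw [Nat.sub_sub, Nat.cast_sub (by omega)]
    push_cast
    field_simp
    ring
  rw [sum_congr rfl h2, sum_neg_distrib] at h
  linarith

open Polynomial Finset in
theorem prod_X_sub_C_sq_dvd {p : ℂ[X]} {S : Finset ℂ}
    (hS : ∀ z ∈ S, p.eval z = 0 ∧ p.derivative.eval z = 0) :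
    ∏ z ∈ S, (X - C z) ^ 2 ∣ p := by
  refine Finset.prod_dvd_of_coprime ?_ ?_
  · intro x _ y _ hxy
    exact (isCoprime_X_sub_C_of_isUnit_sub (sub_ne_zero.2 hxy).isUnit).pow
  · intro z hz
    obtain ⟨h0, h1⟩ := hS z hz
    obtain ⟨q, rfl⟩ := dvd_iff_isRoot.2 h0
    have : q.eval z = 0 := by simpa using h1
    obtain ⟨s, rfl⟩ := dvd_iff_isRoot.2 this
    exact ⟨s, by ring⟩

open Finset in
theorem even_mem_of_card_le {L : ℕ} {Z : ℕ → Prop} [DecidablePred Z] (h0 : Z 0)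
    (hadj : ∀ m < 2 * L, Z m ∨ Z (m + 1)) (hcard : #{m ∈ range (2 * L) | Z m} ≤ L) :
    ∀ j < L, Z (2 * j) := by
  have hsum : ∀ K : ℕ, #{m ∈ range (2 * K) | Z m} =
      ∑ i ∈ range K, ((if Z (2 * i) then 1 else 0) + if Z (2 * i + 1) then 1 else 0) := by
    intro K
    rw [card_filter]
    induction K with
    | zero => simp
    | succ K ih =>
      rw [mul_add, mul_one, sum_range_succ, sum_range_succ, sum_range_succ, ih, add_assoc]
  have hone : ∀ i ∈ range L,
      1 ≤ (if Z (2 * i) then 1 else 0) + if Z (2 * i + 1) then 1 else 0 := by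
    intro i hi
    have := mem_range.1 hi
    rcases hadj (2 * i) (by omega) with h | h <;> simp [h]
  have heq := (sum_eq_sum_iff_of_le hone).1 (le_antisymm (sum_le_sum hone) (by
    rw [← hsum]; simpa using hcard))
  intro j hj
  induction j with
  | zero => exact h0
  | succ j ih =>
    have h1 := ih (by omega)
    have h2 := heq j (mem_range.2 (by omega))
    have h3 : ¬ Z (2 * j + 1) := by
      intro h
      simp [h1, h] at h2
    exact (hadj (2 * j + 1) (by omega)).resolve_left h3

theorem continuous_halfSum (L : ℕ) (c : ℕ → ℂ) : Continuous (halfSum L c) := by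
  unfold halfSum
  fun_prop

theorem halfSum_add_two_pi (L : ℕ) (c : ℕ → ℂ) (t : ℝ) :
    halfSum L c (t + 2 * Real.pi) = - halfSum L c t := by
  unfold halfSum
  rw [← Complex.neg_re, ← Finset.sum_neg_distrib]
  congr 1
  refine Finset.sum_congr rfl fun k _ => ?_
  have : ((k : ℂ) + 1 / 2) * ((t + 2 * Real.pi : ℝ) : ℂ) * Complex.I
      = ((k : ℂ) + 1 / 2) * t * Complex.I + (k * (2 * Real.pi * Complex.I) + Real.pi * Complex.I) := by
    push_cast
    ring
  rw [this, Complex.exp_add, Complex.exp_add, Complex.exp_nat_mul_two_pi_mul_I,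
    Complex.exp_pi_mul_I]
  ring

theorem halfSum_zero_of_sign {L : ℕ} {c : ℕ → ℂ} {σ : ℝ} (hσ : σ = 1 ∨ σ = -1)
    (h : ∀ t : ℝ, 0 ≤ σ * (Real.sin (t / 2) * halfSum L c t)) : halfSum L c 0 = 0 := by
  have hc : Continuous fun t => σ * halfSum L c t := (continuous_halfSum L c).const_mul σ
  have h1 : 0 ≤ σ * halfSum L c 0 := by
    refine ge_of_tendsto (hc.continuousWithinAt (s := Set.Ioi 0) (x := 0)) ?_
    filter_upwards [Ioo_mem_nhdsGT Real.pi_pos] with t ht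
    have hs : 0 < Real.sin (t / 2) :=
      Real.sin_pos_of_pos_of_lt_pi (by linarith [ht.1]) (by linarith [ht.1, ht.2])
    refine nonneg_of_mul_nonneg_right (?_ : 0 ≤ Real.sin (t / 2) * _) hs
    linarith [h t]
  have h2 : σ * halfSum L c 0 ≤ 0 := by
    refine le_of_tendsto (hc.continuousWithinAt (s := Set.Iio 0) (x := 0)) ?_
    filter_upwards [Ioo_mem_nhdsLT (neg_lt_zero.2 Real.pi_pos)] with t ht
    have hs : 0 < -Real.sin (t / 2) := by
      rw [← Real.sin_neg]
      exact Real.sin_pos_of_pos_of_lt_pi (by linarith [ht.2]) (by linarith [ht.1, ht.2])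
    rw [← neg_nonneg]
    refine nonneg_of_mul_nonneg_right (?_ : 0 ≤ -Real.sin (t / 2) * _) hs
    linarith [h t]
  rcases hσ with rfl | rfl <;> linarith

open Polynomial Finset in
/-- The polynomial whose value at `exp (i t)` is
`-4 i exp (i L t) * (sin (t / 2) * halfSum L c t)`. -/
noncomputable def halfSumPoly (L : ℕ) (c : ℕ → ℂ) : ℂ[X] :=
  ∑ k ∈ range L, (C (c k) * (X ^ (L + k) - X ^ (L + k + 1)) -
    C ((starRingEnd ℂ) (c k)) * (X ^ (L - k) - X ^ (L - k - 1)))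

open Polynomial Finset in
theorem halfSumPoly_eval (L : ℕ) (c : ℕ → ℂ) (t : ℝ) :
    (halfSumPoly L c).eval (Complex.exp (t * Complex.I)) =
      -4 * Complex.I * Complex.exp (L * (t * Complex.I)) *
        ((Real.sin (t / 2) * halfSum L c t : ℝ) : ℂ) := by
  have hG : ((halfSum L c t : ℝ) : ℂ) = ∑ k ∈ range L,
      (c k * Complex.exp (((k : ℂ) + 1 / 2) * t * Complex.I) +
        (starRingEnd ℂ) (c k) * Complex.exp (-(((k : ℂ) + 1 / 2) * t * Complex.I))) / 2 := by
    unfold halfSum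
    rw [Complex.re_eq_add_conj, map_sum, ← sum_add_distrib, sum_div]
    refine sum_congr rfl fun k _ => ?_
    rw [map_mul, ← Complex.exp_conj]
    simp [Complex.conj_ofNat]
  have hs : ((Real.sin (t / 2) : ℝ) : ℂ) =
      (Complex.exp (-(t / 2 * Complex.I)) - Complex.exp (t / 2 * Complex.I)) * Complex.I / 2 := by
    rw [Complex.ofReal_sin, Complex.sin]
    push_cast
    ring_nf
  rw [Complex.ofReal_mul, hG, hs, mul_sum, mul_sum, halfSumPoly, eval_finsetSum]
  refine sum_congr rfl fun k hk => ?_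
  have hk := mem_range.1 hk
  simp only [eval_sub, eval_mul, eval_C, eval_pow, eval_X, ← Complex.exp_nat_mul]
  have e1 : Complex.exp ((L + k : ℕ) * (t * Complex.I)) =
      Complex.exp (L * (t * Complex.I)) * (Complex.exp (-(t / 2 * Complex.I)) *
      Complex.exp (((k : ℂ) + 1 / 2) * t * Complex.I)) := by
    rw [← Complex.exp_add, ← Complex.exp_add]
    congr 1
    push_cast
    ring
  have e2 : Complex.exp ((L + k + 1 : ℕ) * (t * Complex.I)) =
      Complex.exp (L * (t * Complex.I)) * (Complex.exp (t / 2 * Complex.I) *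
      Complex.exp (((k : ℂ) + 1 / 2) * t * Complex.I)) := by
    rw [← Complex.exp_add, ← Complex.exp_add]
    congr 1
    push_cast
    ring
  have e3 : Complex.exp ((L - k : ℕ) * (t * Complex.I)) =
      Complex.exp (L * (t * Complex.I)) * (Complex.exp (t / 2 * Complex.I) *
      Complex.exp (-(((k : ℂ) + 1 / 2) * t * Complex.I))) := by
    rw [← Complex.exp_add, ← Complex.exp_add, Nat.cast_sub hk.le]
    congr 1
    ring
  have e4 : Complex.exp ((L - k - 1 : ℕ) * (t * Complex.I)) =
      Complex.exp (L * (t * Complex.I)) * (Complex.exp (-(t / 2 * Complex.I)) *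
      Complex.exp (-(((k : ℂ) + 1 / 2) * t * Complex.I))) := by
    rw [← Complex.exp_add, ← Complex.exp_add, Nat.sub_sub, Nat.cast_sub (by omega)]
    congr 1
    push_cast
    ring
  rw [e1, e2, e3, e4]
  linear_combination (Complex.exp (L * (t * Complex.I)) *
    (Complex.exp (-(t / 2 * Complex.I)) - Complex.exp (t / 2 * Complex.I)) *
    (c k * Complex.exp (((k : ℂ) + 1 / 2) * t * Complex.I) +
        (starRingEnd ℂ) (c k) * Complex.exp (-(((k : ℂ) + 1 / 2) * t * Complex.I)))) *
    Complex.I_sq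

open Polynomial Finset in
theorem halfSumPoly_double_root {L : ℕ} {c : ℕ → ℂ} {σ : ℝ} (hσ : σ = 1 ∨ σ = -1)
    (h : ∀ t : ℝ, 0 ≤ σ * (Real.sin (t / 2) * halfSum L c t)) {t : ℝ}
    (ht : Real.sin (t / 2) * halfSum L c t = 0) :
    (halfSumPoly L c).eval (Complex.exp (t * Complex.I)) = 0 ∧
      (halfSumPoly L c).derivative.eval (Complex.exp (t * Complex.I)) = 0 := by
  have hσ0 : σ ≠ 0 := by rcases hσ with rfl | rfl <;> norm_num
  refine ⟨by rw [halfSumPoly_eval, ht]; simp, ?_⟩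
  set Y : ℝ → ℝ := fun t => Real.sin (t / 2) * halfSum L c t with hY
  have hdiff : DifferentiableAt ℝ Y t := by
    have hd : DifferentiableAt ℝ (fun t : ℝ => ∑ k ∈ range L,
        c k * Complex.exp (((k : ℂ) + 1 / 2) * t * Complex.I)) t := by
      have : DifferentiableAt ℝ (fun s : ℝ => (s : ℂ)) t :=
        Complex.ofRealCLM.differentiableAt
      fun_prop
    have : DifferentiableAt ℝ (halfSum L c) t :=
      Complex.reCLM.differentiableAt.comp t hd
    fun_prop
  have hmin : IsLocalMin (fun t => σ * Y t) t :=
    Filter.Eventually.of_forall fun s => by simpa [hY, ht] using h s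
  have hd0 : deriv Y t = 0 := by
    have := hmin.deriv_eq_zero
    rw [deriv_const_mul _ hdiff] at this
    exact (mul_eq_zero.1 this).resolve_left hσ0
  have hYd : HasDerivAt Y 0 t := hd0 ▸ hdiff.hasDerivAt
  have hE : HasDerivAt (fun s : ℝ => Complex.exp (s * Complex.I))
      (Complex.exp (t * Complex.I) * Complex.I) t := by
    have : HasDerivAt (fun s : ℝ => (s : ℂ) * Complex.I) Complex.I t := by
      simpa using (Complex.ofRealCLM.hasDerivAt (x := t)).mul_const Complex.I
    exact this.cexp
  have hL : HasDerivAt (fun s : ℝ => -4 * Complex.I * Complex.exp (L * (s * Complex.I)) *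
      ((Y s : ℝ) : ℂ)) 0 t := by
    have h1 : DifferentiableAt ℝ
        (fun s : ℝ => -4 * Complex.I * Complex.exp (L * (s * Complex.I))) t := by
      have : DifferentiableAt ℝ (fun s : ℝ => (s : ℂ)) t :=
        Complex.ofRealCLM.differentiableAt
      fun_prop
    have h2 := h1.hasDerivAt.mul hYd.ofReal_comp
    have h3 : Y t = 0 := ht
    exact h2.congr_deriv (by simp [h3])
  have hP : HasDerivAt (fun s : ℝ => (halfSumPoly L c).eval (Complex.exp (s * Complex.I)))
      ((halfSumPoly L c).derivative.eval (Complex.exp (t * Complex.I)) *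
        (Complex.exp (t * Complex.I) * Complex.I)) t :=
    ((halfSumPoly L c).hasDerivAt _).comp t hE
  have heq := hP.unique (by simpa only [halfSumPoly_eval] using hL)
  exact (mul_eq_zero.1 heq).resolve_right
    (mul_ne_zero (Complex.exp_ne_zero _) Complex.I_ne_zero)

open Polynomial Finset in
theorem halfSumPoly_natDegree_le (L : ℕ) (c : ℕ → ℂ) : (halfSumPoly L c).natDegree ≤ 2 * L := by
  refine natDegree_sum_le_of_forall_le _ _ fun k hk => ?_
  have hk := mem_range.1 hk
  refine (natDegree_sub_le_of_le (natDegree_C_mul_le _ _ |>.trans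
    (natDegree_sub_le_of_le (natDegree_X_pow_le _) (natDegree_X_pow_le _)))
    (natDegree_C_mul_le _ _ |>.trans
    (natDegree_sub_le_of_le (natDegree_X_pow_le _) (natDegree_X_pow_le _)))).trans ?_
  omega

open Polynomial Finset in
theorem re_eq_zero_of_sq_dvd_halfSumPoly {L : ℕ} (hL : 0 < L) (c : ℕ → ℂ)
    (h : (X ^ L - 1) ^ 2 ∣ halfSumPoly L c) : (c 0).re = 0 := by
  obtain ⟨q, hq⟩ := h
  have hmon : ((X ^ L - 1 : ℂ[X]) ^ 2).Monic := (monic_X_pow_sub_C 1 hL.ne').pow 2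
  have hdeg : ((X ^ L - 1 : ℂ[X]) ^ 2).natDegree = 2 * L := by
    rw [natDegree_pow]
    congr 1
    simpa using natDegree_X_pow_sub_C (n := L) (r := (1 : ℂ))
  have hq0 : q.natDegree = 0 := by
    by_cases h0 : q = 0
    · simp [h0]
    have := halfSumPoly_natDegree_le L c
    rw [hq, hmon.natDegree_mul' h0, hdeg] at this
    omega
  obtain ⟨b, rfl⟩ : ∃ b, q = C b := ⟨_, eq_C_of_natDegree_eq_zero hq0⟩
  have hexp : halfSumPoly L c = C b * X ^ (2 * L) - C b * (2 * X ^ L) + C b := by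
    rw [hq]
    ring
  have hcoeff : ∀ n : ℕ, (∑ k ∈ range L,
      (c k * ((if n = L + k then 1 else 0) - if n = L + k + 1 then 1 else 0) -
      (starRingEnd ℂ) (c k) * ((if n = L - k then 1 else 0) - if n = L - k - 1 then 1 else 0)))
      = b * (if n = 2 * L then 1 else 0) - 2 * b * (if n = L then 1 else 0)
        + if n = 0 then b else 0 := by
    intro n
    have := congrArg (fun p => coeff p n) hexp
    have h2 : (2 * X ^ L : ℂ[X]).coeff n = 2 * if n = L then 1 else 0 := by
      rw [show (2 * X ^ L : ℂ[X]) = C 2 * X ^ L from rfl, coeff_C_mul, coeff_X_pow]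
    simp only [halfSumPoly, finsetSum_coeff, coeff_sub, coeff_add, coeff_C_mul, h2, coeff_X_pow,
      coeff_C] at this
    rw [this]
    ring
  have hconst : ∀ k < L, c k = c 0 := by
    intro k hk
    induction k with
    | zero => rfl
    | succ k ih =>
      have h1 := hcoeff (L + (k + 1))
      have h2 : ∀ i ∈ range L,
          (c i * ((if L + (k + 1) = L + i then 1 else 0) -
            if L + (k + 1) = L + i + 1 then 1 else 0) -
          (starRingEnd ℂ) (c i) * ((if L + (k + 1) = L - i then 1 else 0) -
            if L + (k + 1) = L - i - 1 then 1 else 0))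
          = (if i = k + 1 then c i else 0) - if i = k then c i else 0 := by
        intro i hi
        have := mem_range.1 hi
        rw [if_neg (by omega : ¬ L + (k + 1) = L - i),
          if_neg (by omega : ¬ L + (k + 1) = L - i - 1)]
        have e1 : (L + (k + 1) = L + i) ↔ (i = k + 1) := by omega
        have e2 : (L + (k + 1) = L + i + 1) ↔ (i = k) := by omega
        simp only [e1, e2, mul_sub, mul_ite, mul_one, mul_zero, sub_zero]
      rw [sum_congr rfl h2, sum_sub_distrib, sum_ite_eq', sum_ite_eq',
        if_pos (mem_range.2 hk), if_pos (mem_range.2 (by omega)),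
        if_neg (by omega), if_neg (by omega), if_neg (by omega), ih (by omega)] at h1
      linear_combination h1
  have htop : b = - c 0 := by
    have h1 := hcoeff (2 * L)
    have h2 : ∀ i ∈ range L,
          (c i * ((if 2 * L = L + i then 1 else 0) -
            if 2 * L = L + i + 1 then 1 else 0) -
          (starRingEnd ℂ) (c i) * ((if 2 * L = L - i then 1 else 0) -
            if 2 * L = L - i - 1 then 1 else 0))
          = - if i = L - 1 then c i else 0 := by
      intro i hi
      have := mem_range.1 hi
      rw [if_neg (by omega : ¬ 2 * L = L - i), if_neg (by omega : ¬ 2 * L = L - i - 1),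
        if_neg (by omega : ¬ 2 * L = L + i)]
      have e2 : (2 * L = L + i + 1) ↔ (i = L - 1) := by omega
      simp only [e2, mul_ite, mul_one, mul_zero, zero_sub, sub_zero, mul_neg]
    rw [sum_congr rfl h2, sum_neg_distrib, sum_ite_eq', if_pos (mem_range.2 (by omega)),
      if_pos rfl, if_neg (by omega), if_neg (by omega), hconst _ (by omega)] at h1
    linear_combination -h1
  have hmid : c 0 - (starRingEnd ℂ) (c 0) = - 2 * b := by
    have h1 := hcoeff L
    have h2 : ∀ i ∈ range L,
          (c i * ((if L = L + i then 1 else 0) - if L = L + i + 1 then 1 else 0) -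
          (starRingEnd ℂ) (c i) * ((if L = L - i then 1 else 0) -
            if L = L - i - 1 then 1 else 0))
          = if i = 0 then c i - (starRingEnd ℂ) (c i) else 0 := by
      intro i hi
      have := mem_range.1 hi
      rw [if_neg (by omega : ¬ L = L - i - 1), if_neg (by omega : ¬ L = L + i + 1)]
      have e1 : (L = L + i) ↔ (i = 0) := by omega
      have e2 : (L = L - i) ↔ (i = 0) := by omega
      simp only [e1, e2]
      split_ifs <;> simp
    rw [sum_congr rfl h2, sum_ite_eq', if_pos (mem_range.2 hL),
      if_neg (by omega), if_pos rfl, if_neg (by omega)] at h1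
    linear_combination h1
  have := congrArg Complex.re hmid
  rw [htop] at this
  simp at this
  linarith

open Polynomial Finset in
theorem re_eq_zero_of_sign {L : ℕ} (hL : 0 < L) {c : ℕ → ℂ} {σ : ℝ} (hσ : σ = 1 ∨ σ = -1)
    (h : ∀ t : ℝ, 0 ≤ σ * (Real.sin (t / 2) * halfSum L c t))
    (hadj : ∀ m < 2 * L,
      halfSum L c (Real.pi * m / L) = 0 ∨ halfSum L c (Real.pi * (m + 1 : ℕ) / L) = 0) :
    (c 0).re = 0 := by
  classical
  have hL' : (L : ℝ) ≠ 0 := by exact_mod_cast hL.ne'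
  have hLC : (L : ℂ) ≠ 0 := by exact_mod_cast hL.ne'
  set ζ : ℕ → ℂ := fun m => Complex.exp ((Real.pi * m / L : ℝ) * Complex.I) with hζ
  have hζinj : ∀ m < 2 * L, ∀ m' < 2 * L, ζ m = ζ m' → m = m' := by
    intro m hm m' hm' heq
    obtain ⟨k, hk⟩ := Complex.exp_eq_exp_iff_exists_int.1 heq
    have h1 : (m : ℂ) = m' + 2 * L * k := by
      have h2 : (Real.pi * Complex.I : ℂ) ≠ 0 := by
        simp [Real.pi_ne_zero]
      have h3 : (Real.pi * Complex.I : ℂ) * m = (Real.pi * Complex.I : ℂ) * (m' + 2 * L * k) := by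
        push_cast at hk
        field_simp at hk
        linear_combination (Real.pi * Complex.I : ℂ) * hk
      exact mul_left_cancel₀ h2 h3
    have h2 : (m : ℤ) - m' = (2 * L : ℕ) * k := by
      have : (m : ℤ) = m' + 2 * L * k := by exact_mod_cast h1
      rw [this]; push_cast; ring
    have := Int.eq_zero_of_abs_lt_dvd ⟨k, h2⟩ (by rw [abs_lt]; omega)
    omega
  have hroot : ∀ m : ℕ, halfSum L c (Real.pi * m / L) = 0 →
      (halfSumPoly L c).eval (ζ m) = 0 ∧ (halfSumPoly L c).derivative.eval (ζ m) = 0 :=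
    fun m hm => halfSumPoly_double_root hσ h (by rw [hm, mul_zero])
  have hG0 := halfSum_zero_of_sign hσ h
  apply re_eq_zero_of_sq_dvd_halfSumPoly hL
  have heven : ∀ j < L, (halfSumPoly L c).eval (ζ (2 * j)) = 0 ∧
      (halfSumPoly L c).derivative.eval (ζ (2 * j)) = 0 := by
    by_cases hp : halfSumPoly L c = 0
    · simp [hp]
    have hZ := even_mem_of_card_le (Z := fun m : ℕ => halfSum L c (Real.pi * m / L) = 0)
      (by simpa using hG0) hadj ?_
    · exact fun j hj => hroot _ (hZ j hj)
    set S := ({m ∈ range (2 * L) | halfSum L c (Real.pi * (m : ℕ) / L) = 0}).image ζ with hS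
    have hcard : #S = #{m ∈ range (2 * L) | halfSum L c (Real.pi * (m : ℕ) / L) = 0} := by
      refine card_image_of_injOn fun m hm m' hm' heq => ?_
      simp only [coe_filter, mem_range, Set.mem_ofPred_eq] at hm hm'
      exact hζinj m hm.1 m' hm'.1 heq
    have hdvd : ∏ z ∈ S, (X - C z) ^ 2 ∣ halfSumPoly L c := by
      refine prod_X_sub_C_sq_dvd fun z hz => ?_
      obtain ⟨m, hm, rfl⟩ := mem_image.1 hz
      exact hroot m (mem_filter.1 hm).2
    have h1 := natDegree_le_of_dvd hdvd hp
    rw [natDegree_prod_of_monic _ _ fun z _ => (monic_X_sub_C z).pow 2] at h1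
    simp only [natDegree_pow, natDegree_X_sub_C, mul_one, sum_const, smul_eq_mul] at h1
    have h2 := halfSumPoly_natDegree_le L c
    rw [← hcard]
    omega
  have hprim : IsPrimitiveRoot (Complex.exp (2 * Real.pi * Complex.I / L)) L :=
    Complex.isPrimitiveRoot_exp L hL.ne'
  rw [X_pow_sub_one_eq_prod hL hprim, ← prod_pow]
  refine prod_X_sub_C_sq_dvd fun z hz => ?_
  have : NeZero L := ⟨hL.ne'⟩
  obtain ⟨j, hj, rfl⟩ := hprim.eq_pow_of_pow_eq_one ((mem_nthRootsFinset hL _).1 hz)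
  have : Complex.exp (2 * Real.pi * Complex.I / L) ^ j = ζ (2 * j) := by
    rw [hζ, ← Complex.exp_nat_mul]
    congr 1
    push_cast
    field_simp
  rw [this]
  exact heven j hj

open Finset in
theorem no_sign_of_fourier {M L : ℕ} (hM : 0 < M) (hL : 0 < L) (e : ℕ → ℕ → ℝ)
    (he : ∀ r < M, ∀ k < L, e r k = 1 ∨ e r k = -1)
    (h : ∀ a < M, ∃ σ : ℝ, (σ = 1 ∨ σ = -1) ∧ ∀ t : ℝ, 0 ≤ σ * (Real.sin (t / 2) *
      halfSum L (fun k => ∑ r ∈ range M,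
        (e r k : ℂ) * Complex.exp (2 * Real.pi * Complex.I * (r * a / M))) t)) : False := by
  set c : ℕ → ℕ → ℂ := fun a k => ∑ r ∈ range M,
        (e r k : ℂ) * Complex.exp (2 * Real.pi * Complex.I * (r * a / M)) with hc
  have hL' : (L : ℝ) ≠ 0 := by exact_mod_cast hL.ne'
  have hLpos : (0 : ℝ) < L := by exact_mod_cast hL
  have htot : ∑ a ∈ range M, ∑ m ∈ range (2 * L),
      halfSum L (c a) (Real.pi * m / L) * halfSum L (c a) (Real.pi * (m + 1 : ℕ) / L) = 0 := by
    simp_rw [sum_halfSum_mul_halfSum hL]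
    rw [← mul_sum, sum_comm]
    simp_rw [← sum_mul]
    have : ∀ k ∈ range L, (∑ a ∈ range M, Complex.normSq (c a k)) *
        Real.cos ((k + 1 / 2) * (Real.pi / L))
        = (M : ℝ) ^ 2 * Real.cos ((k + 1 / 2) * (Real.pi / L)) := by
      intro k hk
      rw [sum_normSq_fourier hM (fun r => e r k) fun r hr => he r hr k (mem_range.1 hk)]
    rw [sum_congr rfl this, ← mul_sum, sum_cos_half_eq_zero hL]
    simp
  have hnn : ∀ a < M, ∀ m < 2 * L,
      0 ≤ halfSum L (c a) (Real.pi * m / L) * halfSum L (c a) (Real.pi * (m + 1 : ℕ) / L) := by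
    intro a ha m hm
    obtain ⟨σ, hσ, hs⟩ := h a ha
    have hG0 : halfSum L (c a) 0 = 0 := halfSum_zero_of_sign hσ hs
    have hG2 : halfSum L (c a) (2 * Real.pi) = 0 := by
      have := halfSum_add_two_pi L (c a) 0
      rwa [hG0, zero_add, neg_zero] at this
    have hpos : ∀ j : ℕ, j ≤ 2 * L → 0 ≤ σ * halfSum L (c a) (Real.pi * j / L) := by
      intro j hj
      rcases Nat.eq_zero_or_pos j with rfl | hj0
      · simp [hG0]
      rcases hj.eq_or_lt with rfl | hj1
      · have : Real.pi * (2 * L : ℕ) / L = 2 * Real.pi := by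
          push_cast; field_simp
        rw [this, hG2, mul_zero]
      have hsin : 0 < Real.sin (Real.pi * j / L / 2) := by
        have hj0' : (0 : ℝ) < j := by exact_mod_cast hj0
        have hj1' : (j : ℝ) < 2 * L := by exact_mod_cast hj1
        apply Real.sin_pos_of_pos_of_lt_pi
        · have := Real.pi_pos
          positivity
        · rw [div_div, div_lt_iff₀ (by positivity)]
          have := Real.pi_pos
          nlinarith
      refine nonneg_of_mul_nonneg_right (?_ : 0 ≤ Real.sin (Real.pi * j / L / 2) * _) hsin
      linarith [hs (Real.pi * j / L)]
    have h1 := mul_nonneg (hpos m hm.le) (hpos (m + 1) hm)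
    rcases hσ with rfl | rfl <;> linarith
  have hzero : ∀ a < M, ∀ m < 2 * L,
      halfSum L (c a) (Real.pi * m / L) * halfSum L (c a) (Real.pi * (m + 1 : ℕ) / L) = 0 := by
    intro a ha m hm
    have h1 := (sum_eq_zero_iff_of_nonneg fun a ha => sum_nonneg fun m hm =>
      hnn a (mem_range.1 ha) m (mem_range.1 hm)).1 htot a (mem_range.2 ha)
    exact (sum_eq_zero_iff_of_nonneg fun m hm =>
      hnn a ha m (mem_range.1 hm)).1 h1 m (mem_range.2 hm)
  have hre : ∀ a < M, (c a 0).re = 0 := by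
    intro a ha
    obtain ⟨σ, hσ, hs⟩ := h a ha
    exact re_eq_zero_of_sign hL hσ hs fun m hm => mul_eq_zero.1 (hzero a ha m hm)
  have hsum : ∑ a ∈ range M, c a 0 = M * e 0 0 := by
    rw [hc, sum_comm, sum_eq_single 0]
    · simp
    · intro r hr hr0
      rw [← mul_sum]
      have := sum_range_exp_eq_zero hM (j := r) (by
        intro hd
        have := Int.le_of_dvd (by omega) hd
        have := mem_range.1 hr
        omega)
      push_cast at this
      rw [this, mul_zero]
    · intro h0
      exact absurd (mem_range.2 hM) h0
  have h1 := congrArg Complex.re hsum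
  rw [Complex.re_sum, sum_eq_zero fun a ha => hre a (mem_range.1 ha)] at h1
  have hMr : (M : ℝ) ≠ 0 := by exact_mod_cast hM.ne'
  have h2 : (M : ℝ) * e 0 0 = 0 := by
    rw [h1]
    simp
  rcases he 0 hM 0 hL with h3 | h3 <;> simp [h3, hMr] at h2

open Filter Topology in
theorem tendsto_mean_exp (l s₀ : ℝ) :
    Tendsto (fun T : ℝ => (T : ℂ)⁻¹ * ∫ s in s₀..(s₀ + T), Complex.exp (l * Complex.I * s))
      atTop (𝓝 (if l = 0 then 1 else 0)) := by
  split_ifs with hl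
  · refine tendsto_const_nhds.congr' ?_
    filter_upwards [eventually_gt_atTop 0] with T hT
    have : (T : ℂ) ≠ 0 := by exact_mod_cast hT.ne'
    simp [hl, this]
  · have hc : (l * Complex.I : ℂ) ≠ 0 := by simp [hl]
    simp_rw [integral_exp_mul_complex hc]
    have hb : Tendsto (fun T : ℝ => |T|⁻¹ * (2 / |l|)) atTop (𝓝 0) := by
      simpa using (tendsto_inv_atTop_zero.comp tendsto_abs_atTop_atTop).mul_const (2 / |l|)
    refine squeeze_zero_norm (fun T => ?_) hb
    have hn : ∀ x : ℝ, ‖Complex.exp (l * Complex.I * x)‖ = 1 := by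
      intro x
      rw [show (l * Complex.I * x : ℂ) = ((l * x : ℝ) : ℂ) * Complex.I by push_cast; ring]
      exact Complex.norm_exp_ofReal_mul_I _
    rw [norm_mul, norm_div, norm_inv, norm_mul, Complex.norm_I, mul_one, Complex.norm_real,
      Complex.norm_real, Real.norm_eq_abs, Real.norm_eq_abs]
    gcongr
    refine (norm_sub_le _ _).trans ?_
    rw [hn, hn]
    norm_num

open Filter Topology in
theorem re_sum_zero_freq_nonneg {ι : Type*} (J : Finset ι) (a : ι → ℂ) (l : ι → ℝ) (s₀ : ℝ)
    (h : ∀ s, s₀ ≤ s → 0 ≤ (∑ j ∈ J, a j * Complex.exp (l j * Complex.I * s)).re) :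
    0 ≤ (∑ j ∈ J, if l j = 0 then a j else 0).re := by
  have h1 : Tendsto (fun T : ℝ => ∑ j ∈ J, a j *
      ((T : ℂ)⁻¹ * ∫ s in s₀..(s₀ + T), Complex.exp (l j * Complex.I * s)))
      atTop (𝓝 (∑ j ∈ J, a j * if l j = 0 then 1 else 0)) :=
    tendsto_finsetSum _ fun j _ => (tendsto_mean_exp (l j) s₀).const_mul _
  have h2 := (Complex.continuous_re.tendsto _).comp h1
  simp only [mul_ite, mul_one, mul_zero] at h2
  refine ge_of_tendsto h2 ?_
  filter_upwards [eventually_gt_atTop 0] with T hT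
  have hcont : ∀ j, Continuous fun s : ℝ => a j * Complex.exp (l j * Complex.I * s) := by
    intro j
    fun_prop
  have h3 : ∑ j ∈ J, a j * ((T : ℂ)⁻¹ * ∫ s in s₀..(s₀ + T), Complex.exp (l j * Complex.I * s))
      = ((T⁻¹ : ℝ) : ℂ) * ∫ s in s₀..(s₀ + T), ∑ j ∈ J, a j * Complex.exp (l j * Complex.I * s) := by
    rw [intervalIntegral.integral_finsetSum fun j _ => (hcont j).intervalIntegrable _ _,
      Finset.mul_sum]
    refine Finset.sum_congr rfl fun j _ => ?_
    rw [intervalIntegral.integral_const_mul]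
    push_cast
    ring
  have h4 : Continuous fun s : ℝ => ∑ j ∈ J, a j * Complex.exp (l j * Complex.I * s) :=
    continuous_finsetSum _ fun j _ => hcont j
  rw [Function.comp_apply, h3, Complex.re_ofReal_mul]
  refine mul_nonneg (inv_nonneg.2 hT.le) ?_
  have h5 := Complex.reCLM.intervalIntegral_comp_comm (h4.intervalIntegrable
    (μ := MeasureTheory.volume) s₀ (s₀ + T))
  simp only [Complex.reCLM_apply] at h5
  rw [← h5]
  exact intervalIntegral.integral_nonneg (by linarith) fun s hs => h s hs.1

theorem exists_int_basis (F : Finset ℝ) : ∃ (r : ℕ) (e : Fin r → ℝ) (q : ℝ → Fin r → ℤ),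
    (∀ n : Fin r → ℤ, ∑ i, (n i : ℝ) * e i = 0 → n = 0) ∧
    (∀ x ∈ F, x = ∑ i, (q x i : ℝ) * e i) ∧ q 0 = 0 := by
  classical
  set V := Submodule.span ℤ (F : Set ℝ)
  have : Module.Finite ℤ V := Module.Finite.span_of_finite ℤ F.finite_toSet
  set b := Module.finBasis ℤ V
  refine ⟨Module.finrank ℤ V, fun i => (b i : ℝ),
    fun x => if hx : x ∈ V then b.equivFun ⟨x, hx⟩ else 0, ?_, ?_, ?_⟩
  · intro n hn
    have h1 : ∑ i, n i • b i = 0 := by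
      apply Subtype.ext
      simpa using hn
    exact funext (Fintype.linearIndependent_iff.1 b.linearIndependent n h1)
  · intro x hx
    have hxV : x ∈ V := Submodule.subset_span hx
    have h1 := congrArg Subtype.val (b.sum_equivFun ⟨x, hxV⟩)
    simp only [dif_pos hxV]
    rw [AddSubmonoidClass.coe_finsetSum] at h1
    exact h1.symm.trans (Finset.sum_congr rfl fun i _ => by simp)
  · have h0 : (0 : ℝ) ∈ V := V.zero_mem
    simp only [dif_pos h0]
    exact map_zero b.equivFun

open Filter in
theorem exists_strictMonoOn_int (F : Finset ℝ) {r : ℕ} {e : Fin r → ℝ} {q : ℝ → Fin r → ℤ}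
    (hq : ∀ x ∈ F, x = ∑ i, (q x i : ℝ) * e i) :
    ∃ m : Fin r → ℤ, ∀ x ∈ F, ∀ y ∈ F, x < y → ∑ i, q x i * m i < ∑ i, q y i * m i := by
  have : ∀ᶠ T : ℝ in atTop, ∀ x ∈ F, ∀ y ∈ F, x < y →
      ∑ i, q x i * round (T * e i) < ∑ i, q y i * round (T * e i) := by
    refine (eventually_all_finset F).2 fun x hx => (eventually_all_finset F).2 fun y hy => ?_
    by_cases hxy : x < y
    swap
    · exact Eventually.of_forall fun T h => absurd h hxy
    set D : ℝ := ∑ i, |((q y i - q x i : ℤ) : ℝ)|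
    filter_upwards [eventually_gt_atTop (D / (y - x)), eventually_gt_atTop 0] with T hT hT0 _
    rw [div_lt_iff₀ (by linarith)] at hT
    have h1 : ∑ i, ((q y i - q x i : ℤ) : ℝ) * (T * e i - round (T * e i)) ≤ D := by
      refine Finset.sum_le_sum fun i _ => ?_
      refine (le_abs_self _).trans ?_
      rw [abs_mul]
      refine mul_le_of_le_one_right (abs_nonneg _) ?_
      have := abs_sub_round (T * e i)
      linarith
    have h2 : ∑ i, ((q y i - q x i : ℤ) : ℝ) * (T * e i - round (T * e i))
        = T * (y - x) - (∑ i, (q y i : ℝ) * round (T * e i) - ∑ i, (q x i : ℝ) * round (T * e i)) := by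
      have hyx : y - x = ∑ i, (q y i : ℝ) * e i - ∑ i, (q x i : ℝ) * e i := by
        rw [← hq x hx, ← hq y hy]
      rw [hyx, ← Finset.sum_sub_distrib, ← Finset.sum_sub_distrib,
        Finset.mul_sum, ← Finset.sum_sub_distrib]
      refine Finset.sum_congr rfl fun i _ => ?_
      push_cast
      ring
    have h3 : (∑ i, (q x i : ℝ) * round (T * e i)) < ∑ i, (q y i : ℝ) * round (T * e i) := by
      rw [h2] at h1
      linarith
    exact_mod_cast h3
  obtain ⟨T, hT⟩ := this.exists
  exact ⟨fun i => round (T * e i), hT⟩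

open Filter Topology Finset in
theorem tendsto_card_shift (r : ℕ) (v : Fin r → ℤ) :
    Tendsto (fun R : ℕ => (#{n ∈ Fintype.piFinset fun _ : Fin r => Ico (0 : ℤ) R |
      n + v ∈ Fintype.piFinset fun _ : Fin r => Ico (0 : ℤ) R} : ℝ) / (R : ℝ) ^ r)
      atTop (𝓝 1) := by
  obtain ⟨Q, hQ⟩ : ∃ Q : ℕ, ∀ i, |v i| ≤ Q := by
    refine ⟨(∑ i, |v i|).toNat, fun i => ?_⟩
    rw [Int.toNat_of_nonneg (sum_nonneg fun i _ => abs_nonneg _)]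
    exact single_le_sum (f := fun i => |v i|) (fun i _ => abs_nonneg _) (mem_univ i)
  have hlow : Tendsto (fun R : ℕ => (1 - 2 * Q * (R : ℝ)⁻¹) ^ r) atTop (𝓝 1) := by
    have : Tendsto (fun R : ℕ => (R : ℝ)⁻¹) atTop (𝓝 0) :=
      tendsto_inv_atTop_zero.comp tendsto_natCast_atTop_atTop
    have := ((this.const_mul (2 * Q : ℝ)).const_sub 1).pow r
    simpa using this
  refine tendsto_of_tendsto_of_tendsto_of_le_of_le' hlow tendsto_const_nhds ?_ ?_
  · filter_upwards [eventually_gt_atTop (2 * Q)] with R hR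
    have hR0 : (0 : ℝ) < R := by
      have : 0 < R := by omega
      exact_mod_cast this
    have hsub : (Fintype.piFinset fun _ : Fin r => Ico (Q : ℤ) (R - Q)) ⊆
        {n ∈ Fintype.piFinset fun _ : Fin r => Ico (0 : ℤ) R |
          n + v ∈ Fintype.piFinset fun _ : Fin r => Ico (0 : ℤ) R} := by
      intro n hn
      simp only [Fintype.mem_piFinset, mem_Ico, mem_filter, Pi.add_apply] at hn ⊢
      refine ⟨fun i => ?_, fun i => ?_⟩ <;>
        (have := hn i; have := abs_le.1 (hQ i); omega)
    have hcard := card_le_card hsub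
    rw [Fintype.card_piFinset] at hcard
    simp only [Int.card_Ico, prod_const, card_univ, Fintype.card_fin] at hcard
    rw [le_div_iff₀ (by positivity), ← mul_pow]
    have h1 : (1 - 2 * Q * (R : ℝ)⁻¹) * R = (((R : ℤ) - Q - Q).toNat : ℝ) := by
      have : (((R : ℤ) - Q - Q).toNat : ℝ) = (((((R : ℤ) - Q - Q).toNat : ℕ) : ℤ) : ℝ) := by
        push_cast; rfl
      rw [this, Int.toNat_of_nonneg (by omega)]
      push_cast
      field_simp
      ring
    rw [h1]
    exact_mod_cast hcard
  · filter_upwards [eventually_gt_atTop 0] with R hR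
    have hR0 : (0 : ℝ) < R := by exact_mod_cast hR
    rw [div_le_one (by positivity)]
    have hcard := card_filter_le (Fintype.piFinset fun _ : Fin r => Ico (0 : ℤ) R)
      fun n => n + v ∈ Fintype.piFinset fun _ : Fin r => Ico (0 : ℤ) R
    rw [Fintype.card_piFinset] at hcard
    simp only [Int.card_Ico, prod_const, card_univ, Fintype.card_fin, sub_zero,
      Int.toNat_natCast] at hcard
    exact_mod_cast hcard

open Finset in
theorem nonneg_sum_card_shift (F : Finset ℝ) {r : ℕ} {e : Fin r → ℝ} {q : ℝ → Fin r → ℤ}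
    (he : ∀ n : Fin r → ℤ, ∑ i, (n i : ℝ) * e i = 0 → n = 0)
    (hq : ∀ x ∈ F, x = ∑ i, (q x i : ℝ) * e i) (m : Fin r → ℤ) (c : ℝ → ℂ) {s₀ : ℝ}
    (h : ∀ s, s₀ ≤ s → 0 ≤ (∑ x ∈ F, c x * Complex.exp (x * Complex.I * s)).re) (t : ℝ)
    (B : Finset (Fin r → ℤ)) :
    0 ≤ (∑ x ∈ F, (#{n ∈ B | n + q x ∈ B} : ℂ) *
      (c x * Complex.exp ((∑ i, q x i * m i : ℤ) * Complex.I * t))).re := by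
  set g : ℝ → ℂ := fun s =>
    ∑ n ∈ B, Complex.exp (((∑ i, (n i : ℝ) * (e i * s - m i * t) : ℝ) : ℂ) * Complex.I) with hg
  set a : ℝ × (Fin r → ℤ) × (Fin r → ℤ) → ℂ := fun p => c p.1 *
    Complex.exp (((-t * ∑ i, (p.2.1 i - p.2.2 i : ℝ) * m i : ℝ) : ℂ) * Complex.I) with ha
  set l : ℝ × (Fin r → ℤ) × (Fin r → ℤ) → ℝ := fun p =>
    p.1 + ∑ i, (p.2.1 i - p.2.2 i : ℝ) * e i with hl
  have hmul : ∀ s : ℝ, ∑ p ∈ F ×ˢ B ×ˢ B, a p * Complex.exp (l p * Complex.I * s)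
      = Complex.normSq (g s) * ∑ x ∈ F, c x * Complex.exp (x * Complex.I * s) := by
    intro s
    rw [Complex.normSq_eq_conj_mul_self, mul_comm, sum_product, sum_mul]
    refine sum_congr rfl fun x _ => ?_
    rw [mul_comm ((starRingEnd ℂ) (g s)), hg, map_sum, sum_mul_sum, sum_product, mul_sum]
    refine sum_congr rfl fun n _ => ?_
    rw [mul_sum]
    refine sum_congr rfl fun n' _ => ?_
    rw [← Complex.exp_conj, map_mul, Complex.conj_ofReal, Complex.conj_I, ha, hl]
    simp only
    rw [mul_assoc (c x) (Complex.exp _), mul_assoc (c x) (Complex.exp _), ← Complex.exp_add,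
      ← Complex.exp_add, ← Complex.exp_add]
    congr 2
    have h1 : -t * ∑ i, (n i - n' i : ℝ) * m i + (∑ i, (n i - n' i : ℝ) * e i) * s =
        (∑ i, (n i : ℝ) * (e i * s - m i * t)) - ∑ i, (n' i : ℝ) * (e i * s - m i * t) := by
      rw [mul_sum, sum_mul, ← sum_add_distrib, ← sum_sub_distrib]
      refine sum_congr rfl fun i _ => ?_
      ring
    have h2 := congrArg (fun y : ℝ => (y : ℂ)) h1
    simp only [Complex.ofReal_add, Complex.ofReal_sub, Complex.ofReal_mul (_ : ℝ) s] at h2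
    rw [Complex.ofReal_add]
    linear_combination Complex.I * h2
  have hpos := re_sum_zero_freq_nonneg (F ×ˢ B ×ˢ B) a l s₀ (fun s hs => by
    rw [hmul s, Complex.re_ofReal_mul]
    exact mul_nonneg (Complex.normSq_nonneg _) (h s hs))
  convert hpos using 2
  rw [sum_product]
  refine sum_congr rfl fun x hx => ?_
  have hzero : ∀ n n' : Fin r → ℤ, l (x, n, n') = 0 ↔ n' = n + q x := by
    intro n n'
    have h1 : l (x, n, n') = ∑ i, ((q x i + n i - n' i : ℤ) : ℝ) * e i := by
      rw [hl]
      simp only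
      nth_rewrite 1 [hq x hx]
      rw [← sum_add_distrib]
      refine sum_congr rfl fun i _ => ?_
      push_cast
      ring
    constructor
    · intro h0
      rw [h1] at h0
      have := he (fun i => q x i + n i - n' i) h0
      funext i
      have := congrFun this i
      simp only [Pi.zero_apply] at this
      simp only [Pi.add_apply]
      omega
    · rintro rfl
      rw [h1]
      refine sum_eq_zero fun i _ => ?_
      simp [add_comm]
  rw [sum_product, card_filter, Nat.cast_sum, sum_mul]
  refine sum_congr rfl fun n _ => ?_
  simp only [hzero]
  rw [sum_ite_eq']
  split_ifs with hn
  · rw [ha]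
    simp only [Nat.cast_one, one_mul, Pi.add_apply]
    congr 2
    have : (-t * ∑ i, ((n i : ℝ) - (n i + q x i : ℤ)) * m i : ℝ)
        = (∑ i, q x i * m i : ℤ) * t := by
      rw [mul_sum]
      push_cast
      rw [sum_mul]
      refine sum_congr rfl fun i _ => ?_
      ring
    rw [this]
    push_cast
    ring
  · simp

open Filter Topology Finset in
/-- Real frequencies can be replaced by integers in the same order in a way that preserves
eventual nonnegativity of trigonometric sums. -/
theorem exists_int_specialization (F : Finset ℝ) : ∃ k : ℝ → ℤ, k 0 = 0 ∧
    StrictMonoOn k F ∧ ∀ (c : ℝ → ℂ) (s₀ : ℝ),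
      (∀ s, s₀ ≤ s → 0 ≤ (∑ x ∈ F, c x * Complex.exp (x * Complex.I * s)).re) →
      ∀ t : ℝ, 0 ≤ (∑ x ∈ F, c x * Complex.exp (k x * Complex.I * t)).re := by
  obtain ⟨r, e, q, he, hq, hq0⟩ := exists_int_basis F
  obtain ⟨m, hm⟩ := exists_strictMonoOn_int F hq
  refine ⟨fun x => ∑ i, q x i * m i, by simp [hq0], fun x hx y hy hxy => hm x hx y hy hxy, ?_⟩
  intro c s₀ h t
  have h1 : Tendsto (fun R : ℕ => ∑ x ∈ F, (((#{n ∈ Fintype.piFinset fun _ : Fin r => Ico (0 : ℤ) R |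
      n + q x ∈ Fintype.piFinset fun _ : Fin r => Ico (0 : ℤ) R} : ℝ) / (R : ℝ) ^ r : ℝ) : ℂ) *
      (c x * Complex.exp ((∑ i, q x i * m i : ℤ) * Complex.I * t))) atTop
      (𝓝 (∑ x ∈ F, ((1 : ℝ) : ℂ) *
        (c x * Complex.exp ((∑ i, q x i * m i : ℤ) * Complex.I * t)))) :=
    tendsto_finsetSum _ fun x _ =>
      ((Complex.continuous_ofReal.tendsto _).comp (tendsto_card_shift r (q x))).mul_const _
  have h2 := (Complex.continuous_re.tendsto _).comp h1
  simp only [Complex.ofReal_one, one_mul] at h2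
  refine ge_of_tendsto h2 (Eventually.of_forall fun R => ?_)
  have h3 := nonneg_sum_card_shift F he hq m c h t
    (Fintype.piFinset fun _ : Fin r => Ico (0 : ℤ) R)
  have h4 : ∀ x : ℝ, (((#{n ∈ Fintype.piFinset fun _ : Fin r => Ico (0 : ℤ) R |
      n + q x ∈ Fintype.piFinset fun _ : Fin r => Ico (0 : ℤ) R} : ℝ) / (R : ℝ) ^ r : ℝ) : ℂ) *
      (c x * Complex.exp ((∑ i, q x i * m i : ℤ) * Complex.I * t))
      = ((((R : ℝ) ^ r)⁻¹ : ℝ) : ℂ) * ((#{n ∈ Fintype.piFinset fun _ : Fin r => Ico (0 : ℤ) R |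
      n + q x ∈ Fintype.piFinset fun _ : Fin r => Ico (0 : ℤ) R} : ℂ) *
      (c x * Complex.exp ((∑ i, q x i * m i : ℤ) * Complex.I * t))) := by
    intro x
    rw [div_eq_inv_mul, Complex.ofReal_mul, Complex.ofReal_natCast]
    ring
  rw [Function.comp_apply, sum_congr rfl fun x _ => h4 x, ← mul_sum, Complex.re_ofReal_mul]
  exact mul_nonneg (by positivity) h3

open Finset in
theorem exists_cut {F : Finset ℝ} {k : ℝ → ℤ} (hk : StrictMonoOn k F) (h0 : (0 : ℝ) ∈ F)
    (h1 : (1 : ℝ) ∈ F) {j : ℤ} (hj0 : k 0 ≤ j) (hj1 : j < k 1) :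
    ∃ y : ℝ, 0 < y ∧ y < 1 ∧ y ∉ F ∧ ∀ x ∈ F, (x < y ↔ k x ≤ j) := by
  have hne : ({x ∈ F | k x ≤ j}).Nonempty := ⟨0, by simp [h0, hj0]⟩
  have hne' : ({x ∈ F | j < k x}).Nonempty := ⟨1, by simp [h1, hj1]⟩
  set u := ({x ∈ F | k x ≤ j}).max' hne with hu
  set v := ({x ∈ F | j < k x}).min' hne' with hv
  have huF := mem_filter.1 (max'_mem _ hne)
  have hvF := mem_filter.1 (min'_mem _ hne')
  rw [← hu] at huF
  rw [← hv] at hvF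
  have hu' : ∀ x ∈ F, k x ≤ j → x ≤ u := fun x hx h => le_max' _ _ (mem_filter.2 ⟨hx, h⟩)
  have hv' : ∀ x ∈ F, j < k x → v ≤ x := fun x hx h => min'_le _ _ (mem_filter.2 ⟨hx, h⟩)
  have huv : u < v := by
    by_contra h
    have := hk.monotoneOn hvF.1 huF.1 (not_lt.1 h)
    linarith [huF.2, hvF.2]
  have hiff : ∀ x ∈ F, (x < (u + v) / 2 ↔ k x ≤ j) := by
    intro x hx
    constructor
    · intro h
      by_contra h2
      have := hv' x hx (not_le.1 h2)
      linarith
    · intro h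
      have := hu' x hx h
      linarith
  have hu0 := hu' 0 h0 hj0
  have hv1 := hv' 1 h1 hj1
  refine ⟨(u + v) / 2, by linarith, by linarith, fun hy => ?_, hiff⟩
  rcases le_or_gt (k ((u + v) / 2)) j with h | h
  · linarith [hu' _ hy h]
  · linarith [hv' _ hy h]

theorem sin_mul_halfSum (L : ℕ) (U : ℕ → ℂ) (t : ℝ) :
    -2 * (Real.sin (t / 2) * halfSum L U t) = (∑ k ∈ Finset.range L, U k *
      (Complex.exp (t * Complex.I) ^ k - Complex.exp (t * Complex.I) ^ (k + 1))).im := by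
  have hs : ((Real.sin (t / 2) : ℝ) : ℂ) =
      (Complex.exp (-(t / 2 * Complex.I)) - Complex.exp (t / 2 * Complex.I)) * Complex.I / 2 := by
    rw [Complex.ofReal_sin, Complex.sin]
    push_cast
    ring_nf
  have h1 : ∑ k ∈ Finset.range L, U k *
      (Complex.exp (t * Complex.I) ^ k - Complex.exp (t * Complex.I) ^ (k + 1))
      = ((-2 * Real.sin (t / 2) : ℝ) : ℂ) * (Complex.I * ∑ k ∈ Finset.range L,
        U k * Complex.exp (((k : ℂ) + 1 / 2) * t * Complex.I)) := by
    rw [Finset.mul_sum, Finset.mul_sum]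
    refine Finset.sum_congr rfl fun k _ => ?_
    rw [Complex.ofReal_mul, hs, ← Complex.exp_nat_mul, ← Complex.exp_nat_mul]
    have e1 : Complex.exp (k * (t * Complex.I)) = Complex.exp (-(t / 2 * Complex.I)) *
        Complex.exp (((k : ℂ) + 1 / 2) * t * Complex.I) := by
      rw [← Complex.exp_add]
      congr 1
      ring
    have e2 : Complex.exp ((k + 1 : ℕ) * (t * Complex.I)) = Complex.exp (t / 2 * Complex.I) *
        Complex.exp (((k : ℂ) + 1 / 2) * t * Complex.I) := by
      rw [← Complex.exp_add]
      congr 1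
      push_cast
      ring
    rw [e1, e2]
    push_cast
    linear_combination U k * Complex.exp (((k : ℂ) + 1 / 2) * t * Complex.I) *
      (Complex.exp (-(t / 2 * Complex.I)) - Complex.exp (t / 2 * Complex.I)) * Complex.I_sq
  rw [h1, Complex.im_ofReal_mul, Complex.I_mul_im]
  unfold halfSum
  ring

open Finset in
theorem sum_partial_sums_mul {K L : ℕ} (v : Fin K → ℂ) (κ : Fin K → ℕ) (hκ : ∀ i, κ i ≤ L)
    (hv : ∑ i, v i = 0) (z : ℂ) :
    ∑ k ∈ range L, (∑ i with κ i ≤ k, v i) * (z ^ k - z ^ (k + 1)) = ∑ i, v i * z ^ κ i := by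
  have h1 : ∀ i, ∑ k ∈ range L, (if κ i ≤ k then v i else 0) * (z ^ k - z ^ (k + 1))
      = v i * (z ^ κ i - z ^ L) := by
    intro i
    obtain ⟨n, hn⟩ := Nat.exists_eq_add_of_le (hκ i)
    have : ∀ k ∈ range L, (if κ i ≤ k then v i else 0) * (z ^ k - z ^ (k + 1))
      = v i * if κ i ≤ k then (z ^ k - z ^ (k + 1)) else 0 := by
      intro k _
      split_ifs <;> simp
    rw [sum_congr rfl this, ← mul_sum, ← sum_filter]
    congr 1
    have h2 : {k ∈ range L | κ i ≤ k} = Ico (κ i) L := by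
      ext k
      simp [and_comm]
    rw [h2, sum_Ico_eq_sub _ (hκ i), sum_range_sub', sum_range_sub']
    ring
  simp_rw [sum_filter, sum_mul]
  rw [sum_comm, sum_congr rfl fun i _ => h1 i]
  simp_rw [mul_sub]
  rw [sum_sub_distrib, ← sum_mul, hv, zero_mul, sub_zero]

open Finset in
/-- There is no step-function configuration whose exponential sums have eventually constant
sign along every residue frequency. -/
theorem no_signed_limit {K M : ℕ} (hM : 0 < M) (x : Fin K → ℝ) (hx : ∀ i, 0 ≤ x i ∧ x i ≤ 1)
    (ρ : Fin K → ℕ) (hρ : ∀ i, ρ i < M) (w : Fin K → ℝ)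
    (hcut : ∀ r < M, ∀ y : ℝ, 0 < y → y < 1 → (∀ i, x i ≠ y) →
      (∑ i with x i < y ∧ ρ i = r, w i = 1 ∨ ∑ i with x i < y ∧ ρ i = r, w i = -1))
    (htot : ∀ r < M, ∑ i with ρ i = r, w i = 0)
    (hsign : ∀ a < M, ∃ σ : ℝ, (σ = 1 ∨ σ = -1) ∧ ∃ s₀ : ℝ, ∀ s, s₀ ≤ s →
      0 ≤ σ * (∑ i, w i * Complex.exp (2 * Real.pi * Complex.I * (ρ i * a / M)) *
        Complex.exp (x i * Complex.I * s)).im) : False := by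
  classical
  set F : Finset ℝ := insert 0 (insert 1 (univ.image x)) with hF
  have h0F : (0 : ℝ) ∈ F := by simp [hF]
  have h1F : (1 : ℝ) ∈ F := by simp [hF]
  have hxF : ∀ i, x i ∈ F := fun i => by simp [hF]
  obtain ⟨k, hk0, hk, hpos⟩ := exists_int_specialization F
  have hL1 : 0 < k 1 := hk0 ▸ hk h0F h1F one_pos
  have hkx : ∀ i, 0 ≤ k (x i) ∧ k (x i) ≤ k 1 := fun i =>
    ⟨hk0 ▸ hk.monotoneOn h0F (hxF i) (hx i).1, hk.monotoneOn (hxF i) h1F (hx i).2⟩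
  set L := (k 1).toNat with hLdef
  have hL : (L : ℤ) = k 1 := Int.toNat_of_nonneg hL1.le
  set κ : Fin K → ℕ := fun i => (k (x i)).toNat with hκdef
  have hκ : ∀ i, (κ i : ℤ) = k (x i) := fun i => Int.toNat_of_nonneg (hkx i).1
  have hκL : ∀ i, κ i ≤ L := fun i => by have := (hkx i).2; have := hκ i; omega
  set e : ℕ → ℕ → ℝ := fun r j => ∑ i with κ i ≤ j ∧ ρ i = r, w i with he
  refine no_sign_of_fourier (L := L) hM (by omega) e ?_ ?_
  · intro r hr j hj
    obtain ⟨y, hy0, hy1, hyF, hy⟩ := exists_cut hk h0F h1F (j := j) (by omega) (by omega)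
    have h1 := hcut r hr y hy0 hy1 fun i hi => hyF (hi ▸ hxF i)
    have h2 : ∀ i, x i < y ↔ κ i ≤ j := fun i => by
      rw [hy _ (hxF i), ← hκ i]
      exact Nat.cast_le
    simpa only [h2] using h1
  · intro a ha
    obtain ⟨σ, hσ, s₀, hs⟩ := hsign a ha
    refine ⟨-σ, by rcases hσ with rfl | rfl <;> simp, fun t => ?_⟩
    set α : ℕ → ℂ := fun r => Complex.exp (2 * Real.pi * Complex.I * (r * a / M)) with hα
    have hU : (fun j => ∑ r ∈ range M, (e r j : ℂ) * α r)
        = fun j => ∑ i with κ i ≤ j, (w i : ℂ) * α (ρ i) := by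
      funext j
      have : ∀ r ∈ range M, (e r j : ℂ) * α r =
          ∑ i with κ i ≤ j, if ρ i = r then (w i : ℂ) * α (ρ i) else 0 := by
        intro r _
        rw [he]
        simp only
        rw [← filter_filter, sum_filter, Complex.ofReal_sum, sum_mul]
        refine sum_congr rfl fun i _ => ?_
        split_ifs with h
        · rw [h]
        · simp
      rw [sum_congr rfl this, sum_comm]
      refine sum_congr rfl fun i _ => ?_
      rw [sum_ite_eq, if_pos (mem_range.2 (hρ i))]
    have hv0 : ∑ i, (w i : ℂ) * α (ρ i) = 0 := by
      have : ∀ r ∈ range M, ∑ i with ρ i = r, (w i : ℂ) * α (ρ i) = 0 := by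
        intro r hr
        have h1 : ∑ i with ρ i = r, (w i : ℂ) * α (ρ i) = (∑ i with ρ i = r, (w i : ℂ)) * α r := by
          rw [sum_mul]
          refine sum_congr rfl fun i hi => ?_
          rw [(mem_filter.1 hi).2]
        rw [h1, ← Complex.ofReal_sum, htot r (mem_range.1 hr)]
        simp
      rw [← sum_fiberwise_of_maps_to (t := range M) (g := ρ) fun i _ => mem_range.2 (hρ i)]
      exact sum_eq_zero this
    have hfib : ∀ φ : ℝ → ℂ, ∑ y ∈ F, (∑ i with x i = y, -Complex.I * (σ * ((w i : ℂ) * α (ρ i)))) * φ y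
        = -Complex.I * (σ * ∑ i, (w i : ℂ) * α (ρ i) * φ (x i)) := by
      intro φ
      rw [mul_sum, mul_sum,
        ← sum_fiberwise_of_maps_to (t := F) (g := x) (s := univ) fun i _ => hxF i]
      refine sum_congr rfl fun y _ => ?_
      rw [sum_mul]
      refine sum_congr rfl fun i hi => ?_
      rw [(mem_filter.1 hi).2]
      ring
    have hre : ∀ z : ℂ, (-Complex.I * (σ * z)).re = σ * z.im := by
      intro z
      simp
    have h1 := hpos (fun y => ∑ i with x i = y, -Complex.I * (σ * ((w i : ℂ) * α (ρ i)))) s₀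
      (fun s hs0 => by
        rw [hfib fun y => Complex.exp (y * Complex.I * s), hre]
        exact hs s hs0) t
    rw [hfib fun y => Complex.exp (k y * Complex.I * t), hre] at h1
    have h2 := sin_mul_halfSum L (fun j => ∑ i with κ i ≤ j, (w i : ℂ) * α (ρ i)) t
    rw [sum_partial_sums_mul (fun i => (w i : ℂ) * α (ρ i)) κ hκL hv0] at h2
    have h3 : ∀ i, Complex.exp (k (x i) * Complex.I * t) = Complex.exp (t * Complex.I) ^ κ i := by
      intro i
      rw [← Complex.exp_nat_mul, ← hκ i]
      congr 1
      push_cast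
      ring
    simp_rw [h3] at h1
    rw [← h2] at h1
    rw [hU]
    linarith

open Finset in
theorem exists_difference_representation {M B N : ℕ} (hBN : B + M ≤ N) {ε : ℕ → ℝ}
    (hε : ∀ n ≤ N, ε n = 1 ∨ ε n = -1)
    (hcard : #{n ∈ range (N + 1) | n + M ≤ N ∧ ε (n + M) ≠ ε n} ≤ B) :
    ∃ (ν : Fin (B + 2 * M) → ℤ) (w : Fin (B + 2 * M) → ℝ),
      (∀ i, |w i| ≤ 2) ∧ (∀ i, -(M : ℤ) ≤ ν i ∧ ν i ≤ N) ∧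
      ∀ g : ℤ → ℂ, ∑ i, (w i : ℂ) * g (ν i) =
        ∑ n ∈ range (N + 1), (ε n : ℂ) * (g (n - M) - g n) := by
  classical
  set E : ℤ → ℝ := fun m => if 0 ≤ m ∧ m ≤ N then ε m.toNat else 0 with hE
  have hEabs : ∀ m, |E m| ≤ 1 := by
    intro m
    simp only [hE]
    split_ifs with h
    · rcases hε m.toNat (by omega) with h | h <;> simp [h]
    · simp
  have hEnat : ∀ n ∈ range (N + 1), E n = ε n := by
    intro n hn
    have := mem_range.1 hn
    simp only [hE]
    rw [if_pos (by omega), Int.toNat_natCast]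
  set T : Finset ℤ := Icc (-(M : ℤ)) N with hT
  set δ : ℤ → ℝ := fun m => E (m + M) - E m with hδ
  set S := {m ∈ T | δ m ≠ 0} with hS
  have hScard : #S ≤ B + 2 * M := by
    have hsub : S ⊆ Ico (-(M : ℤ)) 0 ∪
        (({n ∈ range (N + 1) | n + M ≤ N ∧ ε (n + M) ≠ ε n}).image (fun n : ℕ => (n : ℤ)) ∪
          Ioc ((N : ℤ) - M) N) := by
      intro m hm
      obtain ⟨hmT, hm0⟩ := mem_filter.1 hm
      have hmT := mem_Icc.1 hmT
      rw [mem_union, mem_union, mem_Ico, mem_Ioc]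
      by_cases h1 : m < 0
      · exact Or.inl ⟨hmT.1, h1⟩
      by_cases h2 : (N : ℤ) - M < m
      · exact Or.inr (Or.inr ⟨h2, hmT.2⟩)
      refine Or.inr (Or.inl (mem_image.2 ⟨m.toNat, mem_filter.2 ⟨mem_range.2 (by omega),
        by omega, fun h => hm0 ?_⟩, by omega⟩))
      simp only [hδ, hE]
      rw [if_pos (by omega), if_pos (by omega), sub_eq_zero]
      rw [← h]
      congr 1
      omega
    refine (card_le_card hsub).trans ((card_union_le _ _).trans
      ((Nat.add_le_add_left (card_union_le _ _) _).trans ?_))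
    have h1 := (card_image_le (f := fun n : ℕ => (n : ℤ))).trans hcard
    rw [Int.card_Ico, Int.card_Ioc]
    omega
  obtain ⟨U, hSU, hUT, hU⟩ := exists_subsuperset_card_eq (filter_subset _ T) hScard
    (by rw [hT, Int.card_Icc]; omega)
  set φ := U.orderEmbOfFin hU
  have hφ : ∀ i, φ i ∈ T := fun i => hUT (orderEmbOfFin_mem U hU i)
  refine ⟨φ, fun i => δ (φ i), ?_, fun i => mem_Icc.1 (hφ i), ?_⟩
  · intro i
    refine (abs_sub _ _).trans ?_
    linarith [hEabs (φ i + M), hEabs (φ i)]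
  · intro g
    have h1 : ∑ i, (δ (φ i) : ℂ) * g (φ i) = ∑ m ∈ U, (δ m : ℂ) * g m := by
      conv_rhs => rw [← map_orderEmbOfFin_univ U hU]
      rw [sum_map]
      rfl
    have h2 : ∑ m ∈ U, (δ m : ℂ) * g m = ∑ m ∈ T, (δ m : ℂ) * g m := by
      refine sum_subset hUT fun m hm hmU => ?_
      have : δ m = 0 := by
        by_contra h
        exact hmU (hSU (mem_filter.2 ⟨hm, h⟩))
      simp [this]
    have hshift : ∀ c : ℤ, 0 ≤ c → c ≤ M → ∑ m ∈ T, (E (m + c) : ℂ) * g m =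
        ∑ n ∈ range (N + 1), (ε n : ℂ) * g (n - c) := by
      intro c hc0 hcM
      have h3 : ∑ n ∈ range (N + 1), (ε n : ℂ) * g (n - c) =
          ∑ m ∈ (range (N + 1)).image (fun n : ℕ => (n : ℤ) - c), (E (m + c) : ℂ) * g m := by
        rw [sum_image (by intro a _ b _ h; simpa using h)]
        refine sum_congr rfl fun n hn => ?_
        rw [sub_add_cancel, hEnat n hn]
      rw [h3]
      symm
      refine sum_subset ?_ ?_
      · intro m hm
        obtain ⟨n, hn, rfl⟩ := mem_image.1 hm
        have := mem_range.1 hn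
        rw [hT, mem_Icc]
        omega
      · intro m hm hm'
        have : E (m + c) = 0 := by
          simp only [hE]
          rw [if_neg]
          intro h
          exact hm' (mem_image.2 ⟨(m + c).toNat, mem_range.2 (by omega), by omega⟩)
        simp [this]
    rw [h1, h2]
    have h4 : ∑ m ∈ T, (δ m : ℂ) * g m =
        ∑ m ∈ T, (E (m + M) : ℂ) * g m - ∑ m ∈ T, (E (m + 0) : ℂ) * g m := by
      rw [← sum_sub_distrib]
      refine sum_congr rfl fun m _ => ?_
      simp only [hδ]
      push_cast
      rw [add_zero]
      ring
    rw [h4, hshift M (by omega) le_rfl, hshift 0 le_rfl (by omega), ← sum_sub_distrib]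
    refine sum_congr rfl fun n _ => ?_
    rw [sub_zero]
    ring

theorem lt_ncard_zeros_of_alternating {f : ℝ → ℝ} (hf : Continuous f) {d : ℕ} {θ : ℕ → ℝ}
    (hmono : ∀ n ≤ d, θ n < θ (n + 1)) (hsign : ∀ n ≤ d + 1, 0 < (-1) ^ n * f (θ n))
    {a b : ℝ} (ha : a ≤ θ 0) (hb : θ (d + 1) ≤ b) (hfin : {t | t ∈ Set.Icc a b ∧ f t = 0}.Finite) :
    d < {t | t ∈ Set.Icc a b ∧ f t = 0}.ncard := by
  have hle : ∀ m n, m ≤ n → n ≤ d + 1 → θ m ≤ θ n := by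
    intro m n hmn hn
    induction n, hmn using Nat.le_induction with
    | base => exact le_rfl
    | succ n _ ih => exact (ih (by omega)).trans (hmono n (by omega)).le
  have hz : ∀ n : ℕ, ∃ z, n ≤ d → θ n < z ∧ z < θ (n + 1) ∧ f z = 0 := by
    intro n
    by_cases hn : n ≤ d
    swap
    · exact ⟨0, fun h => absurd h hn⟩
    have hcont : ContinuousOn (fun t => (-1) ^ n * f t) (Set.Icc (θ n) (θ (n + 1))) := by
      fun_prop
    have h1 := hsign n (by omega)
    have h2 := hsign (n + 1) (by omega)
    rw [pow_succ] at h2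
    obtain ⟨z, hz, hz0⟩ := intermediate_value_Ioo' (hmono n hn).le hcont
      (show (0 : ℝ) ∈ _ from ⟨by linarith, h1⟩)
    refine ⟨z, fun _ => ⟨hz.1, hz.2, ?_⟩⟩
    exact (mul_eq_zero.1 hz0).resolve_left (pow_ne_zero _ (by norm_num))
  choose z hz using hz
  have hinj : Set.InjOn z (Finset.range (d + 1) : Set ℕ) := by
    have key : ∀ m n, m < n → n ≤ d → z m < z n := by
      intro m n hmn hn
      exact (hz m (by omega)).2.1.trans_le ((hle (m + 1) n hmn (by omega)).trans (hz n hn).1.le)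
    intro m hm n hn h
    have hm := Finset.mem_range.1 hm
    have hn := Finset.mem_range.1 hn
    rcases lt_trichotomy m n with h1 | h1 | h1
    · exact absurd h (key m n h1 (by omega)).ne
    · exact h1
    · exact absurd h (key n m h1 (by omega)).ne'
  have hcard := Set.ncard_le_ncard (s := z '' (Finset.range (d + 1) : Set ℕ)) (by
    rintro _ ⟨n, hn, rfl⟩
    have hn := Finset.mem_range.1 hn
    obtain ⟨h1, h2, h3⟩ := hz n (by omega)
    refine ⟨⟨?_, ?_⟩, h3⟩
    · exact ha.trans ((hle 0 n (by omega) (by omega)).trans h1.le)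
    · exact h2.le.trans ((hle (n + 1) (d + 1) (by omega) le_rfl).trans hb)) hfin
  rw [hinj.ncard_image, Set.ncard_coe_finset, Finset.card_range] at hcard
  omega

open Finset in
theorem cos_sum_mul_sin {N M : ℕ} (hM : 0 < M) (ε : ℕ → ℝ) (a : ℕ) (t : ℝ) :
    2 * Real.sin (M * t / 2) *
        ∑ n ∈ range (N + 1), ε n * Real.cos (n * (2 * Real.pi * a / M + t)) =
      -(Complex.exp (((M * t / 2 : ℝ) : ℂ) * Complex.I) * ∑ n ∈ range (N + 1), (ε n : ℂ) *
        (Complex.exp ((((n - M : ℤ) : ℝ) * (2 * Real.pi * a / M + t) : ℝ) * Complex.I) -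
          Complex.exp ((((n : ℤ) : ℝ) * (2 * Real.pi * a / M + t) : ℝ) * Complex.I))).im := by
  have hM' : (M : ℂ) ≠ 0 := by exact_mod_cast hM.ne'
  set θ : ℝ := 2 * Real.pi * a / M + t with hθ
  have hs : ((Real.sin (M * t / 2) : ℝ) : ℂ) =
      (Complex.exp (-(M * t / 2 * Complex.I)) - Complex.exp (M * t / 2 * Complex.I)) *
        Complex.I / 2 := by
    rw [Complex.ofReal_sin, Complex.sin]
    push_cast
    ring_nf
  have hmain : Complex.exp (((M * t / 2 : ℝ) : ℂ) * Complex.I) * ∑ n ∈ range (N + 1), (ε n : ℂ) *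
        (Complex.exp ((((n - M : ℤ) : ℝ) * θ : ℝ) * Complex.I) -
          Complex.exp ((((n : ℤ) : ℝ) * θ : ℝ) * Complex.I))
      = ((-2 * Real.sin (M * t / 2) : ℝ) : ℂ) * (Complex.I *
        ∑ n ∈ range (N + 1), (ε n : ℂ) * Complex.exp ((n * θ : ℝ) * Complex.I)) := by
    rw [mul_sum, mul_sum, mul_sum]
    refine sum_congr rfl fun n _ => ?_
    have e1 : Complex.exp ((((n - M : ℤ) : ℝ) * θ : ℝ) * Complex.I) =
        Complex.exp ((n * θ : ℝ) * Complex.I) * (Complex.exp (-(M * t / 2 * Complex.I)) *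
          Complex.exp (-(M * t / 2 * Complex.I))) := by
      rw [← Complex.exp_add, ← Complex.exp_add, Complex.exp_eq_exp_iff_exists_int]
      refine ⟨-a, ?_⟩
      rw [hθ]
      push_cast
      field_simp
      ring
    have e2 : Complex.exp ((((n : ℤ) : ℝ) * θ : ℝ) * Complex.I) =
        Complex.exp ((n * θ : ℝ) * Complex.I) := by
      push_cast
      rfl
    have e3 : Complex.exp (((M * t / 2 : ℝ) : ℂ) * Complex.I) =
        Complex.exp (M * t / 2 * Complex.I) := by
      push_cast
      rfl
    have e4 : Complex.exp (M * t / 2 * Complex.I) * Complex.exp (-(M * t / 2 * Complex.I)) = 1 := by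
      rw [← Complex.exp_add, add_neg_cancel, Complex.exp_zero]
    rw [e1, e2, e3, Complex.ofReal_mul (-2), hs]
    push_cast
    linear_combination (ε n : ℂ) * Complex.exp ((n * θ) * Complex.I) *
      (Complex.exp (-(M * t / 2 * Complex.I)) - Complex.exp (M * t / 2 * Complex.I)) *
      Complex.I_sq + (ε n : ℂ) * Complex.exp ((n * θ) * Complex.I) *
      Complex.exp (-(M * t / 2 * Complex.I)) * e4
  rw [hmain, Complex.im_ofReal_mul, Complex.I_mul_im, Complex.re_sum]
  have : ∀ n ∈ range (N + 1), ((ε n : ℂ) * Complex.exp ((n * θ : ℝ) * Complex.I)).re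
      = ε n * Real.cos (n * θ) := by
    intro n _
    rw [Complex.re_ofReal_mul, Complex.exp_ofReal_mul_I_re]
  rw [sum_congr rfl this]
  ring

open Filter Topology in
theorem Ultrafilter.exists_tendsto_of_mem_Icc {ι : Type*} (U : Ultrafilter ι) {u : ι → ℝ} {a b : ℝ}
    (hu : ∀ j, u j ∈ Set.Icc a b) : ∃ x, Tendsto u U (𝓝 x) := by
  obtain ⟨x, _, hx⟩ := (isCompact_Icc (a := a) (b := b)).ultrafilter_le_nhds' (U.map u)
    (show Set.Icc a b ∈ U.map u from Filter.Eventually.of_forall (f := (U : Filter ι)) hu)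
  exact ⟨x, hx⟩

open Filter in
theorem Ultrafilter.exists_eventually_eq {ι α : Type*} [Finite α] (U : Ultrafilter ι) (u : ι → α) :
    ∃ c, ∀ᶠ j in (U : Filter ι), u j = c := by
  obtain ⟨c, hc⟩ := (U.map u).eq_pure_of_finite
  have h : ({c} : Set α) ∈ U.map u := by
    rw [hc]
    exact Set.mem_singleton c
  exact ⟨c, h⟩

open Finset in
theorem sum_cut_difference {M N k r : ℕ} (hM : 0 < M) (hr : r < M) (hN : k * M + r ≤ N)
    (ε : ℕ → ℝ) :
    ∑ n ∈ range (N + 1), (ε n : ℂ) *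
      ((if ((n : ℤ) - M) < k * M + r ∧ ((n : ℤ) - M) % M = r then 1 else 0) -
        (if (n : ℤ) < k * M + r ∧ (n : ℤ) % M = r then 1 else 0)) = ε (k * M + r) := by
  rw [sum_eq_single (k * M + r)]
  · have h2 : (((k * M + r : ℕ) : ℤ) - M) % M = r := by
      rw [Int.sub_emod_right]
      push_cast
      rw [add_comm, Int.add_mul_emod_self_right]
      exact Int.emod_eq_of_lt (by omega) (by omega)
    rw [if_pos ⟨by push_cast; omega, h2⟩, if_neg (by push_cast; omega)]
    simp
  · intro n _ hne
    rw [Int.sub_emod_right]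
    by_cases h : (n : ℤ) % M = r
    swap
    · simp [h]
    have hiff : ((n : ℤ) - M < k * M + r) ↔ ((n : ℤ) < k * M + r) := by
      constructor
      · intro h1
        have h2 := Int.emod_add_mul_ediv (n : ℤ) M
        rw [h] at h2
        set c := (n : ℤ) / M
        have h3 : c < k + 1 := by
          by_contra hc
          have : (M : ℤ) * (k + 1) ≤ M * c := by gcongr; omega
          nlinarith
        have h4 : c ≠ k := by
          intro hc
          rw [hc] at h2
          apply hne
          have : (n : ℤ) = k * M + r := by linarith [mul_comm (k : ℤ) M]
          exact_mod_cast this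
        have h5 : c + 1 ≤ k := by omega
        have : (M : ℤ) * (c + 1) ≤ M * k := by gcongr
        nlinarith
      · intro h1
        omega
    simp [hiff]
  · intro h
    exact absurd (mem_range.2 (by omega)) h

open Filter Topology Finset in
theorem exists_bound_of_almost_periodic {d M B : ℕ} (hM : 0 < M) :
    ∃ N₀ : ℕ, ∀ N : ℕ, N₀ ≤ N → ∀ ε : ℕ → ℝ, (∀ n ≤ N, ε n = 1 ∨ ε n = -1) →
      #{n ∈ range (N + 1) | n + M ≤ N ∧ ε (n + M) ≠ ε n} ≤ B →
      {θ : ℝ | θ ∈ Set.Icc 0 (2 * Real.pi) ∧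
        ∑ n ∈ range (N + 1), ε n * Real.cos (n * θ) = 0}.Finite →
      d < {θ : ℝ | θ ∈ Set.Icc 0 (2 * Real.pi) ∧
        ∑ n ∈ range (N + 1), ε n * Real.cos (n * θ) = 0}.ncard := by
  by_contra! hcon
  choose N hN ε hε hcard hfin hd using fun j : ℕ => hcon (B + M + 1 + j)
  have hBN : ∀ j, B + M ≤ N j := fun j => by have := hN j; omega
  choose ν w hw hν hrep using fun j => exists_difference_representation (hBN j) (hε j) (hcard j)
  have hNpos : ∀ j, (0 : ℝ) < N j := fun j => by
    have : 0 < N j := by have := hN j; omega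
    exact_mod_cast this
  have hMN : ∀ j, (M : ℝ) ≤ N j := fun j => by
    have : M ≤ N j := by have := hN j; omega
    exact_mod_cast this
  have hM0 : (0 : ℝ) < M := by exact_mod_cast hM
  have hMC : (M : ℂ) ≠ 0 := by exact_mod_cast hM.ne'
  set U : Ultrafilter ℕ := hyperfilter ℕ
  have hUtop : (U : Filter ℕ) ≤ atTop := by
    rw [← Nat.cofinite_eq_atTop]
    exact hyperfilter_le_cofinite
  have hNtop : Tendsto (fun j => (N j : ℝ)) U atTop := by
    refine Tendsto.mono_left ?_ hUtop
    refine tendsto_natCast_atTop_atTop.comp ?_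
    exact tendsto_atTop_mono (fun j => show j ≤ N j by have := hN j; omega) tendsto_id
  have hNinv : ∀ c : ℝ, Tendsto (fun j => c / (N j : ℝ)) U (𝓝 0) := fun c =>
    hNtop.const_div_atTop c
  choose w' hw' using fun i => U.exists_tendsto_of_mem_Icc (u := fun j => w j i) (a := -2) (b := 2)
    fun j => abs_le.1 (hw j i)
  choose x hx using fun i => U.exists_tendsto_of_mem_Icc (u := fun j => (ν j i : ℝ) / N j)
    (a := -1) (b := 1) fun j => by
      have h1 : -(M : ℝ) ≤ ν j i := by exact_mod_cast (hν j i).1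
      have h2 : (ν j i : ℝ) ≤ N j := by exact_mod_cast (hν j i).2
      constructor
      · rw [le_div_iff₀ (hNpos j)]
        linarith [hMN j]
      · rw [div_le_one (hNpos j)]
        exact h2
  have hmod : ∀ j i, (ν j i % M).toNat < M := fun j i => by
    have := Int.emod_lt_of_pos (ν j i) (b := M) (by omega)
    have := Int.emod_nonneg (ν j i) (b := M) (by omega)
    omega
  obtain ⟨ρ', hρ'⟩ := U.exists_eventually_eq fun j => fun i => (⟨_, hmod j i⟩ : Fin M)
  set ρ : Fin (B + 2 * M) → ℕ := fun i => ρ' i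
  have hρ : ∀ᶠ j in (U : Filter ℕ), ∀ i, ν j i % M = ρ i := by
    filter_upwards [hρ'] with j hj i
    have h1 := congrArg Fin.val (congrFun hj i)
    have := Int.emod_nonneg (ν j i) (b := M) (by omega)
    simp only at h1
    simp only [ρ]
    omega
  refine no_signed_limit hM x ?_ ρ (fun i => (ρ' i).2) w' ?_ ?_ ?_
  · intro i
    constructor
    · refine le_of_tendsto_of_tendsto' (hNinv (-M)) (hx i) fun j => ?_
      have h1 : -(M : ℝ) ≤ ν j i := by exact_mod_cast (hν j i).1
      have := (hNpos j).le
      gcongr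
    · refine le_of_tendsto' (hx i) fun j => ?_
      have h2 : (ν j i : ℝ) ≤ N j := by exact_mod_cast (hν j i).2
      rw [div_le_one (hNpos j)]
      exact h2
  · intro r hr y hy0 hy1 hxy
    have hlim : Tendsto (fun j => ∑ i with x i < y ∧ ρ i = r, w j i) U
        (𝓝 (∑ i with x i < y ∧ ρ i = r, w' i)) :=
      tendsto_finsetSum _ fun i _ => hw' i
    have hclosed : IsClosed ({1, -1} : Set ℝ) := (Set.toFinite _).isClosed
    refine hclosed.mem_of_tendsto hlim ?_
    have hk : Tendsto (fun j => ((⌊y * N j / M⌋₊ * M + r : ℕ) : ℝ) / N j) U (𝓝 y) := by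
      refine tendsto_of_tendsto_of_tendsto_of_le_of_le (g := fun j => y - M / N j)
        (h := fun j => y + M / N j) ?_ ?_ ?_ ?_
      · simpa using (hNinv M).const_sub y
      · simpa using (hNinv M).const_add y
      · intro j
        have h1 := Nat.lt_floor_add_one (y * N j / M)
        rw [div_lt_iff₀ hM0] at h1
        have h2 : (0 : ℝ) ≤ r := by positivity
        simp only
        rw [le_div_iff₀ (hNpos j), sub_mul, div_mul_cancel₀ _ (hNpos j).ne']
        push_cast
        linarith
      · intro j
        have h1 := Nat.floor_le (a := y * N j / M) (by have := hNpos j; positivity)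
        rw [le_div_iff₀ hM0] at h1
        have h2 : (r : ℝ) ≤ M := by exact_mod_cast hr.le
        simp only
        rw [div_le_iff₀ (hNpos j), add_mul, div_mul_cancel₀ _ (hNpos j).ne']
        push_cast
        linarith
    have hlt : ∀ᶠ j in (U : Filter ℕ), ⌊y * N j / M⌋₊ * M + r ≤ N j := by
      filter_upwards [hk.eventually_lt_const hy1] with j hj
      rw [div_lt_one (hNpos j)] at hj
      exact_mod_cast hj.le
    have hcmp : ∀ᶠ j in (U : Filter ℕ), ∀ i,
        (ν j i < (⌊y * N j / M⌋₊ : ℤ) * M + r ↔ x i < y) := by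
      refine eventually_all.2 fun i => ?_
      have hcast : ∀ j, (((⌊y * N j / M⌋₊ : ℤ) * M + r : ℤ) : ℝ) =
          ((⌊y * N j / M⌋₊ * M + r : ℕ) : ℝ) := fun j => by push_cast; rfl
      rcases lt_or_gt_of_ne (hxy i) with h | h
      · filter_upwards [(hx i).eventually_lt hk h] with j hj
        simp only [h, iff_true]
        rw [div_lt_div_iff_of_pos_right (hNpos j), ← hcast] at hj
        exact_mod_cast hj
      · filter_upwards [hk.eventually_lt (hx i) h] with j hj
        simp only [not_lt.2 h.le, iff_false, not_lt]
        rw [div_lt_div_iff_of_pos_right (hNpos j), ← hcast] at hj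
        exact_mod_cast hj.le
    filter_upwards [hlt, hcmp, hρ] with j h1 h2 h3
    have h4 := hrep j fun m =>
      if m < (⌊y * N j / M⌋₊ : ℤ) * M + r ∧ m % M = r then 1 else 0
    rw [sum_cut_difference hM hr h1] at h4
    have h5 : ∑ i with x i < y ∧ ρ i = r, w j i = ε j (⌊y * N j / M⌋₊ * M + r) := by
      have : ((∑ i with x i < y ∧ ρ i = r, w j i : ℝ) : ℂ) =
          (ε j (⌊y * N j / M⌋₊ * M + r) : ℂ) := by
        rw [← h4, Complex.ofReal_sum, sum_filter]
        refine sum_congr rfl fun i _ => ?_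
        simp only [h2, h3, Nat.cast_inj, mul_ite, mul_one, mul_zero]
      exact_mod_cast this
    rw [h5]
    exact hε j _ h1
  · intro r hr
    have hlim : Tendsto (fun j => ∑ i with ρ i = r, w j i) U
        (𝓝 (∑ i with ρ i = r, w' i)) :=
      tendsto_finsetSum _ fun i _ => hw' i
    refine tendsto_nhds_unique hlim (tendsto_const_nhds.congr' ?_)
    filter_upwards [hρ] with j h3
    have h4 := hrep j fun m => if m % M = r then 1 else 0
    have : ((∑ i with ρ i = r, w j i : ℝ) : ℂ) = 0 := by
      rw [Complex.ofReal_sum, sum_filter]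
      simp only [h3, Nat.cast_inj, mul_ite, mul_one, mul_zero, Int.sub_emod_right, sub_self,
        sum_const_zero] at h4
      exact h4
    exact_mod_cast this.symm
  · intro a ha
    set X : ℝ → ℂ := fun s => ∑ i, w' i * Complex.exp (2 * Real.pi * Complex.I * (ρ i * a / M)) *
        Complex.exp (x i * Complex.I * s) with hX
    set f : ℕ → ℝ → ℝ := fun j θ => ∑ n ∈ range (N j + 1), ε j n * Real.cos (n * θ) with hf
    have hlim : ∀ s : ℝ, Tendsto (fun j => 2 * Real.sin (M * (s / N j) / 2) *
        f j (2 * Real.pi * a / M + s / N j)) U (𝓝 (-(X s).im)) := by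
      intro s
      have h1 : Tendsto (fun j => -(Complex.exp (((M * (s / N j) / 2 : ℝ) : ℂ) * Complex.I) *
          ∑ i, w j i * Complex.exp (2 * Real.pi * Complex.I * (ρ i * a / M)) *
            Complex.exp (((ν j i : ℝ) / N j : ℝ) * Complex.I * s)).im) U (𝓝 (-(X s).im)) := by
        have h2 : Tendsto (fun j => Complex.exp (((M * (s / N j) / 2 : ℝ) : ℂ) * Complex.I)) U
            (𝓝 1) := by
          have h3 : Tendsto (fun j => M * (s / N j) / 2) U (𝓝 0) := by
            simpa using ((hNinv s).const_mul (M : ℝ)).div_const 2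
          have h4 : Continuous fun y : ℝ => Complex.exp ((y : ℂ) * Complex.I) := by fun_prop
          have h5 := (h4.tendsto 0).comp h3
          rw [Complex.ofReal_zero, zero_mul, Complex.exp_zero] at h5
          exact h5
        have h5 : Tendsto (fun j => ∑ i, w j i *
            Complex.exp (2 * Real.pi * Complex.I * (ρ i * a / M)) *
            Complex.exp (((ν j i : ℝ) / N j : ℝ) * Complex.I * s)) U (𝓝 (X s)) := by
          refine tendsto_finsetSum _ fun i _ => ?_
          have h6 : Continuous fun y : ℝ => Complex.exp ((y : ℂ) * Complex.I * s) := by fun_prop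
          exact (((Complex.continuous_ofReal.tendsto _).comp (hw' i)).mul_const _).mul
            ((h6.tendsto _).comp (hx i))
        have h7 := ((Complex.continuous_im.tendsto _).comp (h2.mul h5)).neg
        simpa using h7
      refine h1.congr' ?_
      filter_upwards [hρ] with j h3
      rw [hf, cos_sum_mul_sin hM]
      have h4 := hrep j fun m => Complex.exp (((m : ℝ) * (2 * Real.pi * a / M + s / N j) : ℝ) *
        Complex.I)
      rw [← h4]
      congr 3
      refine sum_congr rfl fun i _ => ?_
      rw [mul_assoc, ← Complex.exp_add]
      congr 1
      rw [Complex.exp_eq_exp_iff_exists_int]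
      refine ⟨-(a * (ν j i / M)), ?_⟩
      have h5 : (ν j i : ℂ) = ρ i + M * (ν j i / M : ℤ) := by
        have := Int.emod_add_mul_ediv (ν j i) M
        rw [h3] at this
        exact_mod_cast this.symm
      have h6 : (N j : ℂ) ≠ 0 := by exact_mod_cast (hNpos j).ne'
      push_cast
      field_simp
      linear_combination (-2 * Real.pi * a * N j) * h5
    by_contra! hno
    have hstep : ∀ (n : ℕ) (s₀ : ℝ), ∃ s, s₀ ≤ s ∧ (-1) ^ n * (X s).im < 0 := fun n s₀ =>
      hno ((-1) ^ n) (neg_one_pow_eq_or ℝ n) s₀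
    choose nxt hnxt hnxtX using hstep
    let S : ℕ → ℝ := fun n => Nat.rec (nxt 0 1) (fun n s => nxt (n + 1) (s + 1)) n
    have hSmono : ∀ n, S n + 1 ≤ S (n + 1) := fun n => hnxt (n + 1) (S n + 1)
    have hS0 : 1 ≤ S 0 := hnxt 0 1
    have hSX : ∀ n, (-1) ^ n * (X (S n)).im < 0 := by
      intro n
      cases n with
      | zero => exact hnxtX 0 1
      | succ n => exact hnxtX (n + 1) (S n + 1)
    have hSm : StrictMono S := strictMono_nat_of_lt_succ fun n => by linarith [hSmono n]
    have hSpos : ∀ n, 0 < S n := fun n => by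
      have := hSm.monotone (Nat.zero_le n)
      linarith
    have hev : ∀ᶠ j in (U : Filter ℕ), ∀ n ∈ range (d + 2),
        0 < (-1) ^ n * f j (2 * Real.pi * a / M + S n / N j) := by
      refine (eventually_all_finset _).2 fun n _ => ?_
      have h1 : Tendsto (fun j => (-1) ^ n * (2 * Real.sin (M * (S n / N j) / 2) *
        f j (2 * Real.pi * a / M + S n / N j))) U (𝓝 ((-1) ^ n * (-(X (S n)).im))) :=
        (hlim (S n)).const_mul _
      have h2 : Tendsto (fun j => M * (S n / N j) / 2) U (𝓝 0) := by
        simpa using ((hNinv (S n)).const_mul (M : ℝ)).div_const 2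
      filter_upwards [h1.eventually_const_lt (by linarith [hSX n] : (0 : ℝ) < _),
        h2.eventually_lt_const Real.pi_pos] with j hj1 hj2
      have h3 : 0 < M * (S n / N j) / 2 := by
        have := hNpos j
        have := hSpos n
        positivity
      have h4 : 0 < 2 * Real.sin (M * (S n / N j) / 2) := by
        linarith [Real.sin_pos_of_pos_of_lt_pi h3 hj2]
      refine pos_of_mul_pos_right (?_ : 0 < 2 * Real.sin (M * (S n / N j) / 2) * _) h4.le
      linarith
    have hend : ∀ᶠ j in (U : Filter ℕ), S (d + 1) / N j < 2 * Real.pi / M :=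
      (hNinv _).eventually_lt_const (by have := Real.pi_pos; positivity)
    obtain ⟨j, hj, hj2⟩ := (hev.and hend).exists
    have hcont : Continuous (f j) := by fun_prop
    refine (lt_ncard_zeros_of_alternating hcont (d := d) (a := 0) (b := 2 * Real.pi)
      (θ := fun n => 2 * Real.pi * a / M + S n / N j) ?_
      (fun n hn => hj n (mem_range.2 (by omega))) ?_ ?_ (hfin j)).not_ge (hd j)
    · intro n _
      have := hNpos j
      have := hSm (Nat.lt_succ_self n)
      gcongr
    · have := Real.pi_pos
      have := hNpos j
      have := hSpos 0
      positivity
    · have h1 : (a : ℝ) + 1 ≤ M := by exact_mod_cast ha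
      have h2 : 2 * Real.pi * a / M + 2 * Real.pi / M ≤ 2 * Real.pi := by
        rw [← add_div, div_le_iff₀ hM0]
        have := Real.pi_pos
        nlinarith
      linarith

open Finset in
theorem Finset.sum_product_eq_sum_lt_add_sum_diag (Y : Finset ℤ) (F : ℤ → ℤ → ℂ) :
    ∑ m ∈ Y, ∑ k ∈ Y, F m k =
      ∑ p ∈ Y ×ˢ Y with p.2 < p.1, (F p.1 p.2 + F p.2 p.1) + ∑ m ∈ Y, F m m := by
  have h1 : ∑ p ∈ Y ×ˢ Y with p.2 < p.1, F p.2 p.1 = ∑ p ∈ Y ×ˢ Y with p.1 < p.2, F p.1 p.2 := by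
    refine sum_nbij' Prod.swap Prod.swap ?_ ?_ ?_ ?_ ?_ <;> simp +contextual
  have h2 : ∑ m ∈ Y, F m m = ∑ p ∈ Y ×ˢ Y with p.1 = p.2, F p.1 p.2 := by
    refine sum_nbij' (fun m => (m, m)) Prod.fst ?_ ?_ ?_ ?_ ?_ <;> simp +contextual
  rw [← sum_product', sum_add_distrib, h1, h2, sum_filter, sum_filter, sum_filter,
    ← sum_add_distrib, ← sum_add_distrib]
  refine sum_congr rfl fun p _ => ?_
  rcases lt_trichotomy p.1 p.2 with h | h | h
  · simp [h, h.ne, h.not_gt]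
  · simp [h]
  · simp [h, h.ne', h.not_gt]

open Finset in
theorem sum_zpow_mul_conj {Y : Finset ℤ} {τ : ℤ → ℝ} (hτ : ∀ m, τ m ^ 2 = 1) {z : ℂ}
    (hz : ‖z‖ = 1) :
    ((‖∑ m ∈ Y, τ m * z ^ m‖ ^ 2 : ℝ) : ℂ) =
      (∑ p ∈ Y ×ˢ Y with p.2 < p.1, (τ p.1 * τ p.2 * z ^ (p.1 - p.2) : ℂ)) +
      (starRingEnd ℂ) (∑ p ∈ Y ×ˢ Y with p.2 < p.1, (τ p.1 * τ p.2 * z ^ (p.1 - p.2) : ℂ)) +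
      #Y := by
  have hz0 : z ≠ 0 := by
    rintro rfl
    simp at hz
  have hc : (starRingEnd ℂ) z = z⁻¹ := (Complex.inv_eq_conj hz).symm
  have h1 : ((‖∑ m ∈ Y, τ m * z ^ m‖ ^ 2 : ℝ) : ℂ) =
      ∑ m ∈ Y, ∑ k ∈ Y, (τ m * τ k * z ^ (m - k) : ℂ) := by
    push_cast
    rw [← Complex.mul_conj', map_sum, sum_mul_sum]
    refine sum_congr rfl fun m _ => sum_congr rfl fun k _ => ?_
    rw [map_mul, map_zpow₀, hc, Complex.conj_ofReal, inv_zpow, zpow_sub₀ hz0]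
    ring
  rw [h1, Finset.sum_product_eq_sum_lt_add_sum_diag, sum_add_distrib, map_sum]
  congr 1
  · congr 1
    refine sum_congr rfl fun p _ => ?_
    rw [map_mul, map_mul, map_zpow₀, hc, Complex.conj_ofReal, Complex.conj_ofReal, inv_zpow,
      ← zpow_neg, neg_sub]
    ring
  · simp only [sub_self, zpow_zero, mul_one, ← pow_two, ← Complex.ofReal_pow, hτ]
    simp

theorem norm_one_sub_add_le {ρ : ℝ} (hρ : 2 ≤ ρ) {t b : ℝ} (ht : 0 ≤ t) (htρ : t ≤ ρ ^ 2)
    (hb : |b| ≤ ρ ^ 4) :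
    ‖(1 : ℂ) - (ρ⁻¹ ^ 6 : ℝ) * ((t ^ 2 : ℝ) + (b : ℝ) * Complex.I)‖ + 2 * ρ⁻¹ ^ 5 * t ≤
      1 + 2 * ρ⁻¹ ^ 4 := by
  have hρ0 : 0 < ρ := by linarith
  set x := ρ⁻¹ with hx
  have hx0 : 0 < x := by positivity
  have hxρ : x * ρ = 1 := inv_mul_cancel₀ hρ0.ne'
  have hx2 : x ≤ 1 / 2 := by
    rw [hx, inv_le_comm₀ hρ0 (by norm_num)]
    norm_num
    linarith
  have hxx : x ^ 2 ≤ 1 / 4 := by nlinarith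
  set A := 1 - x ^ 6 * t ^ 2 with hA
  set B := x ^ 6 * b with hB
  have hA1 : 1 / 2 ≤ A := by
    have h1 : t ^ 2 ≤ (ρ ^ 2) ^ 2 := pow_le_pow_left₀ ht htρ 2
    have h2 : x ^ 6 * t ^ 2 ≤ x ^ 6 * (ρ ^ 2) ^ 2 := by gcongr
    have h3 : x ^ 6 * (ρ ^ 2) ^ 2 = x ^ 2 * (x * ρ) ^ 4 := by ring
    rw [h3, hxρ] at h2
    linarith
  have hB1 : B ^ 2 ≤ x ^ 4 := by
    have h1 : |B| ≤ x ^ 6 * ρ ^ 4 := by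
      rw [hB, abs_mul, abs_of_pos (by positivity : 0 < x ^ 6)]
      gcongr
    have h3 : x ^ 6 * ρ ^ 4 = x ^ 2 * (x * ρ) ^ 4 := by ring
    rw [h3, hxρ, one_pow, mul_one] at h1
    calc B ^ 2 = |B| ^ 2 := (sq_abs B).symm
      _ ≤ (x ^ 2) ^ 2 := pow_le_pow_left₀ (abs_nonneg _) h1 2
      _ = x ^ 4 := by ring
  have h1 : ‖(1 : ℂ) - (x ^ 6 : ℝ) * ((t ^ 2 : ℝ) + (b : ℝ) * Complex.I)‖ ≤ A + B ^ 2 := by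
    have : (1 : ℂ) - (x ^ 6 : ℝ) * ((t ^ 2 : ℝ) + (b : ℝ) * Complex.I) =
        (A : ℂ) + ((-B : ℝ) : ℂ) * Complex.I := by
      rw [hA, hB]
      push_cast
      ring
    rw [this, Complex.norm_add_mul_I]
    refine Real.sqrt_le_iff.2 ⟨by positivity, ?_⟩
    nlinarith [sq_nonneg (B ^ 2), sq_nonneg B]
  have h2 : 2 * x ^ 5 * t - x ^ 6 * t ^ 2 ≤ x ^ 4 := by
    have : 0 ≤ (x ^ 3 * t - x ^ 2) ^ 2 := sq_nonneg _
    nlinarith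
  linarith

open Finset in
theorem norm_multiplier_le {ρ : ℕ} (hρ : 2 ≤ ρ) {Y : Finset ℤ} (hY : #Y = ρ ^ 2) {τ : ℤ → ℝ}
    (hτ : ∀ m, τ m ^ 2 = 1) {z : ℂ} (hz : ‖z‖ = 1) :
    ‖(1 : ℂ) - ((ρ : ℝ)⁻¹ ^ 6 : ℝ) * ((ρ : ℝ) ^ 2 +
      2 * ∑ p ∈ Y ×ˢ Y with p.2 < p.1, (τ p.1 * τ p.2 * z ^ (p.1 - p.2) : ℂ))‖ +
      2 * (ρ : ℝ)⁻¹ ^ 5 * ‖∑ m ∈ Y, τ m * z ^ m‖ ≤ 1 + 2 * (ρ : ℝ)⁻¹ ^ 4 := by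
  have key := sum_zpow_mul_conj (Y := Y) hτ hz
  have hτ1 : ∀ m, ‖(τ m : ℂ)‖ = 1 := fun m => by
    rw [Complex.norm_real, Real.norm_eq_abs]
    exact (pow_eq_one_iff_of_nonneg (abs_nonneg _) two_ne_zero).1 (by rw [sq_abs, hτ])
  have hn : ∀ k : ℤ, ‖z ^ k‖ = 1 := fun k => by rw [norm_zpow, hz, one_zpow]
  set t := ‖∑ m ∈ Y, τ m * z ^ m‖ with ht
  set W := ∑ p ∈ Y ×ˢ Y with p.2 < p.1, (τ p.1 * τ p.2 * z ^ (p.1 - p.2) : ℂ) with hW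
  have ht1 : t ≤ (ρ : ℝ) ^ 2 := by
    refine (norm_sum_le _ _).trans ?_
    simp only [norm_mul, hτ1, hn, mul_one, sum_const, hY, nsmul_eq_mul]
    push_cast
    exact le_rfl
  have hcard : 2 * (#{p ∈ Y ×ˢ Y | p.2 < p.1} : ℝ) ≤ (ρ : ℝ) ^ 4 := by
    have h1 := Finset.sum_product_eq_sum_lt_add_sum_diag Y fun _ _ => 1
    simp only [sum_const, nsmul_eq_mul, mul_one, hY] at h1
    have h2 : ρ ^ 2 * ρ ^ 2 = #{p ∈ Y ×ˢ Y | p.2 < p.1} * (1 + 1) + ρ ^ 2 := by exact_mod_cast h1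
    have h3 : 2 * #{p ∈ Y ×ˢ Y | p.2 < p.1} ≤ ρ ^ 4 := by
      have : ρ ^ 4 = ρ ^ 2 * ρ ^ 2 := by ring
      omega
    exact_mod_cast h3
  have hWn : |2 * W.im| ≤ (ρ : ℝ) ^ 4 := by
    have h1 : ‖W‖ ≤ #{p ∈ Y ×ˢ Y | p.2 < p.1} := by
      refine (norm_sum_le _ _).trans ?_
      simp only [norm_mul, hτ1, hn, mul_one, sum_const, nsmul_eq_mul]
      exact le_rfl
    rw [abs_mul, abs_two]
    have := Complex.abs_im_le_norm W
    linarith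
  have hre : (ρ : ℝ) ^ 2 + 2 * W = ((t ^ 2 : ℝ) : ℂ) + ((2 * W.im : ℝ) : ℂ) * Complex.I := by
    rw [key, hY]
    apply Complex.ext
    · simp [pow_two]
      ring
    · simp [pow_two]
  have h := norm_one_sub_add_le (ρ := ρ) (by exact_mod_cast hρ) (norm_nonneg _) ht1 hWn
  rw [← hre] at h
  exact h

open Finset in
theorem Finset.le_card_filter_card_lt (S : Finset ℤ) (U : ℕ) (hU : U ≤ #S) :
    U ≤ #{m ∈ S | #{s ∈ S | m < s} < U} := by
  induction S using Finset.induction_on_min with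
  | empty => simpa using hU
  | insert a S ha ih =>
    have haS : a ∉ S := fun h => lt_irrefl a (ha a h)
    rw [card_insert_of_notMem haS] at hU
    rcases hU.lt_or_eq with h | h
    · refine (ih (by omega)).trans (card_le_card fun m hm => ?_)
      rw [mem_filter] at hm ⊢
      refine ⟨mem_insert_of_mem hm.1, ?_⟩
      rw [filter_insert, if_neg (ha m hm.1).not_gt]
      exact hm.2
    · refine le_of_eq ?_
      rw [filter_true_of_mem, card_insert_of_notMem haS, h]
      intro m hm
      rw [h, ← card_insert_of_notMem haS]
      refine card_lt_card (filter_ssubset.2 ⟨m, hm, lt_irrefl m⟩)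

open Finset in
theorem Finset.exists_subset_sub_notMem {S Q : Finset ℤ} {u : ℕ}
    (hQ : ∀ q ∈ Q, #{s ∈ S | q < s} ≤ u) (r : ℕ) :
    ∀ T ⊆ S, r * (#Q * u + 1) ≤ #T → ∃ Y ⊆ T, #Y = r ∧
      ∀ m ∈ Y, ∀ k ∈ Y, k < m → ∀ q ∈ Q, q + m - k ∉ S := by
  induction r with
  | zero => exact fun T _ _ => ⟨∅, empty_subset _, rfl, by simp⟩
  | succ r ih =>
    intro T hTS hT
    have hne : T.Nonempty := by
      rw [← card_pos]
      refine lt_of_lt_of_le (by positivity) hT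
    set k := T.min' hne with hk
    have hkT : k ∈ T := T.min'_mem hne
    set bad := Q.biUnion fun q => {m ∈ T.erase k | q + m - k ∈ S} with hbad
    have hlt : ∀ m ∈ T.erase k, k < m := fun m hm =>
      lt_of_le_of_ne (T.min'_le m (mem_of_mem_erase hm)) (ne_of_mem_erase hm).symm
    have hbadcard : #bad ≤ #Q * u := by
      refine card_biUnion_le_card_mul _ _ _ fun q hq => ?_
      refine le_trans (card_le_card_of_injOn (fun m => q + m - k) ?_ ?_) (hQ q hq)
      · intro m hm
        simp only [coe_filter, Set.mem_ofPred_eq] at hm ⊢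
        have := hlt m hm.1
        exact ⟨hm.2, by omega⟩
      · intro m _ m' _ h
        simp only at h
        omega
    obtain ⟨Y, hYT, hYc, hY⟩ := ih (T.erase k \ bad)
      ((sdiff_subset.trans (erase_subset _ _)).trans hTS) (by
        have h1 := le_card_sdiff bad (T.erase k)
        rw [card_erase_of_mem hkT] at h1
        have h2 : (r + 1) * (#Q * u + 1) = r * (#Q * u + 1) + #Q * u + 1 := by ring
        omega)
    have hYe : ∀ m ∈ Y, m ∈ T.erase k ∧ m ∉ bad := fun m hm => mem_sdiff.1 (hYT hm)
    have hkY : k ∉ Y := fun h => (mem_erase.1 (hYe k h).1).1 rfl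
    refine ⟨insert k Y, ?_, by rw [card_insert_of_notMem hkY, hYc], ?_⟩
    · exact insert_subset hkT fun m hm => mem_of_mem_erase (hYe m hm).1
    · intro m hm l hl hlm q hq
      rcases mem_insert.1 hm with rfl | hm
      · rcases mem_insert.1 hl with rfl | hl
        · exact absurd hlm (lt_irrefl _)
        · exact absurd hlm (hlt l (hYe l hl).1).not_gt
      · rcases mem_insert.1 hl with rfl | hl
        · intro hS
          exact (hYe m hm).2 (mem_biUnion.2 ⟨q, hq, mem_filter.2 ⟨(hYe m hm).1, hS⟩⟩)
        · exact hY m hm l hl hlm q hq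

open Finset in
theorem exists_improved_trigPoly {ι : Type} [Fintype ι] {a : ℤ → ℝ} {S : Finset ℤ} {ρ : ℕ}
    (hρ : 2 ≤ ρ) {δ η A : ℝ} {u : ℕ} (hδ : 0 < δ) {c : ι → ℂ} {n : ι → ℤ}
    (hΦ : ∀ z : ℂ, ‖z‖ = 1 → ‖∑ i, c i * z ^ n i‖ ≤ 1)
    (hu : ∀ i, #{s ∈ S | n i < s} ≤ u) (hA : ∑ i, ‖c i‖ ≤ A)
    (hS : ∀ m ∈ S, δ ≤ |a m|) (hη0 : 0 ≤ η) (hS' : ∀ m ∉ S, |a m| ≤ η) (hη : 2 * ρ * A * η ≤ δ)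
    (hV : (∑ i, c i * a (n i)).re ≤ ρ * δ / 4)
    (hcard : ρ ^ 2 * (Fintype.card ι * u + 1) ≤ #S) :
    ∃ (ι' : Type) (_ : Fintype ι') (c' : ι' → ℂ) (n' : ι' → ℤ),
      (∀ z : ℂ, ‖z‖ = 1 → ‖∑ i, c' i * z ^ n' i‖ ≤ 1) ∧
      (∀ i, #{s ∈ S | n' i < s} ≤ max u (ρ ^ 2 * (Fintype.card ι * u + 1))) ∧
      ∑ i, ‖c' i‖ ≤ 2 * A + 1 ∧
      Fintype.card ι' ≤ Fintype.card ι + Fintype.card ι * ρ ^ 4 + ρ ^ 2 ∧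
      (∑ i, c i * a (n i)).re + (ρ : ℝ)⁻¹ ^ 3 * δ / 4 ≤ (∑ i, c' i * a (n' i)).re := by
  classical
  set U := ρ ^ 2 * (Fintype.card ι * u + 1) with hU
  have hρR : (2 : ℝ) ≤ ρ := by exact_mod_cast hρ
  have hρ0 : (0 : ℝ) < ρ := by linarith
  set x : ℝ := (ρ : ℝ)⁻¹ with hx
  have hx0 : 0 < x := by positivity
  have hxρ : x * ρ = 1 := inv_mul_cancel₀ hρ0.ne'
  have hx2 : x ≤ 1 / 2 := by nlinarith
  obtain ⟨Y, hYT, hYc, hY⟩ := Finset.exists_subset_sub_notMem (S := S) (Q := univ.image n) (u := u)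
    (by simpa using hu) (ρ ^ 2) {m ∈ S | #{s ∈ S | m < s} < U} (filter_subset _ _) (by
      refine le_trans ?_ (Finset.le_card_filter_card_lt S U hcard)
      have : #(univ.image n) ≤ Fintype.card ι := card_image_le
      rw [hU]
      gcongr)
  have hYS : ∀ m ∈ Y, m ∈ S ∧ #{s ∈ S | m < s} < U := fun m hm => mem_filter.1 (hYT hm)
  have hYn : ∀ m ∈ Y, ∀ k ∈ Y, k < m → ∀ i, n i + m - k ∉ S := fun m hm k hk h i =>
    hY m hm k hk h (n i) (mem_image_of_mem n (mem_univ i))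
  set P := {p ∈ Y ×ˢ Y | p.2 < p.1} with hP
  set τ : ℤ → ℝ := fun m => if 0 ≤ a m then 1 else -1 with hτdef
  have hτ : ∀ m, τ m ^ 2 = 1 := fun m => by
    simp only [hτdef]
    split_ifs <;> norm_num
  have hτa : ∀ m, τ m * a m = |a m| := fun m => by
    simp only [hτdef]
    split_ifs with h
    · rw [one_mul, abs_of_nonneg h]
    · rw [neg_one_mul, abs_of_neg (not_le.1 h)]
  have hτ1 : ∀ m, |τ m| = 1 := fun m =>
    (pow_eq_one_iff_of_nonneg (abs_nonneg _) two_ne_zero).1 (by rw [sq_abs, hτ])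
  have hτ1' : ∀ m, ‖(τ m : ℂ)‖ = 1 := fun m => by
    rw [Complex.norm_real, Real.norm_eq_abs, hτ1]
  have hPcard : 2 * (#P : ℝ) ≤ (ρ : ℝ) ^ 4 ∧ #P ≤ ρ ^ 4 := by
    have h1 := Finset.sum_product_eq_sum_lt_add_sum_diag Y fun _ _ => 1
    simp only [sum_const, nsmul_eq_mul, mul_one, hYc] at h1
    have h2 : ρ ^ 2 * ρ ^ 2 = #P * (1 + 1) + ρ ^ 2 := by exact_mod_cast h1
    have h4 : ρ ^ 4 = ρ ^ 2 * ρ ^ 2 := by ring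
    refine ⟨?_, by omega⟩
    have h3 : 2 * #P ≤ ρ ^ 4 := by omega
    exact_mod_cast h3
  set D : ℝ := 1 + 2 * x ^ 4 with hD
  have hD0 : 0 < D := by positivity
  have hD1 : 1 ≤ D := by rw [hD]; linarith [pow_pos hx0 4]
  set α : ℝ := 1 - x ^ 6 * ρ ^ 2 with hα
  have hα1 : α = 1 - x ^ 4 := by
    have : x ^ 6 * ρ ^ 2 = x ^ 4 * (x * ρ) ^ 2 := by ring
    rw [hα, this, hxρ]
    ring
  have hx4 : x ^ 4 ≤ 1 / 16 := by
    have := pow_le_pow_left₀ hx0.le hx2 4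
    norm_num at this ⊢
    exact this
  set c' : ι ⊕ (ι × P) ⊕ Y → ℂ := Sum.elim (fun i => c i * (α / D : ℝ))
    (Sum.elim (fun q => c q.1 * (-(2 * x ^ 6 * (τ q.2.1.1 * τ q.2.1.2)) / D : ℝ))
      (fun m => (2 * x ^ 5 * τ m / D : ℝ))) with hc'
  set n' : ι ⊕ (ι × P) ⊕ Y → ℤ := Sum.elim n
    (Sum.elim (fun q => n q.1 + q.2.1.1 - q.2.1.2) (fun m => m)) with hn'
  have hsum : ∀ g : ℤ → ℂ, ∑ i, c' i * g (n' i) = (α / D : ℝ) * ∑ i, c i * g (n i) +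
      (∑ i, ∑ p ∈ P, c i * (-(2 * x ^ 6 * (τ p.1 * τ p.2)) / D : ℝ) * g (n i + p.1 - p.2) +
      ∑ m ∈ Y, (2 * x ^ 5 * τ m / D : ℝ) * g m) := by
    intro g
    rw [Fintype.sum_sum_type, Fintype.sum_sum_type, Fintype.sum_prod_type]
    simp only [hc', hn', Sum.elim_inl, Sum.elim_inr]
    congr 1
    · rw [mul_sum]
      refine sum_congr rfl fun i _ => by ring
    congr 1
    · refine sum_congr rfl fun i _ => ?_
      exact sum_coe_sort P fun p =>
        c i * (-(2 * x ^ 6 * (τ p.1 * τ p.2)) / D : ℝ) * g (n i + p.1 - p.2)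
    · exact sum_coe_sort Y fun m => ((2 * x ^ 5 * τ m / D : ℝ) : ℂ) * g m
  refine ⟨ι ⊕ (ι × P) ⊕ Y, inferInstance, c', n', ?_, ?_, ?_, ?_, ?_⟩
  · intro z hz
    have hz0 : z ≠ 0 := by
      rintro rfl
      simp at hz
    have hmul := norm_multiplier_le hρ hYc hτ hz
    rw [hsum fun k => z ^ k]
    have hfac : ((α / D : ℝ) : ℂ) * ∑ i, c i * z ^ n i +
        (∑ i, ∑ p ∈ P, c i * (-(2 * x ^ 6 * (τ p.1 * τ p.2)) / D : ℝ) * z ^ (n i + p.1 - p.2) +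
        ∑ m ∈ Y, (2 * x ^ 5 * τ m / D : ℝ) * z ^ m) =
        ((∑ i, c i * z ^ n i) * ((1 : ℂ) - ((ρ : ℝ)⁻¹ ^ 6 : ℝ) * ((ρ : ℝ) ^ 2 +
          2 * ∑ p ∈ P, (τ p.1 * τ p.2 * z ^ (p.1 - p.2) : ℂ))) +
          2 * (x : ℂ) ^ 5 * ∑ m ∈ Y, τ m * z ^ m) / D := by
      have e1 : ∑ i, ∑ p ∈ P, c i * (-(2 * x ^ 6 * (τ p.1 * τ p.2)) / D : ℝ) *
          z ^ (n i + p.1 - p.2) = (∑ i, c i * z ^ n i) * (-(2 * (x : ℂ) ^ 6) / D) *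
          ∑ p ∈ P, (τ p.1 * τ p.2 * z ^ (p.1 - p.2) : ℂ) := by
        rw [sum_mul, sum_mul]
        refine sum_congr rfl fun i _ => ?_
        rw [mul_sum]
        refine sum_congr rfl fun p _ => ?_
        rw [add_sub_assoc, zpow_add₀ hz0]
        push_cast
        ring
      have e2 : ∑ m ∈ Y, ((2 * x ^ 5 * τ m / D : ℝ) : ℂ) * z ^ m =
          2 * (x : ℂ) ^ 5 * (∑ m ∈ Y, τ m * z ^ m) / D := by
        rw [mul_sum, sum_div]
        refine sum_congr rfl fun m _ => ?_
        push_cast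
        ring
      rw [e1, e2, hα, ← hx]
      push_cast
      ring
    rw [hfac, norm_div, Complex.norm_real, Real.norm_of_nonneg hD0.le, div_le_one hD0]
    refine (norm_add_le _ _).trans (le_trans (add_le_add ?_ ?_) hmul)
    · rw [norm_mul]
      exact mul_le_of_le_one_left (norm_nonneg _) (hΦ z hz)
    · rw [norm_mul, norm_mul, norm_pow, Complex.norm_real, Real.norm_of_nonneg hx0.le,
        Complex.norm_ofNat]
  · rintro (i | ⟨i, p⟩ | m)
    · exact (hu i).trans (le_max_left _ _)
    · refine le_trans (card_le_card fun s hs => ?_) ((hu i).trans (le_max_left _ _))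
      have hp := (mem_filter.1 p.2).2
      simp only [hn', Sum.elim_inr, Sum.elim_inl, mem_filter] at hs ⊢
      exact ⟨hs.1, by omega⟩
    · exact (hYS m m.2).2.le.trans (le_max_right _ _)
  · rw [Fintype.sum_sum_type, Fintype.sum_sum_type, Fintype.sum_prod_type]
    simp only [hc', Sum.elim_inl, Sum.elim_inr, norm_mul, Complex.norm_real, Real.norm_eq_abs,
      abs_div, abs_neg, abs_mul, hτ1, abs_of_pos hD0, abs_two, abs_of_pos (pow_pos hx0 _), mul_one]
    have hc0 : 0 ≤ ∑ i, ‖c i‖ := sum_nonneg fun i _ => norm_nonneg _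
    have hα0 : |α| / D ≤ 1 := by
      rw [div_le_one hD0, hα1, abs_of_nonneg (by linarith)]
      linarith [pow_pos hx0 4]
    have t1 : ∑ i, ‖c i‖ * (|α| / D) ≤ A := by
      rw [← sum_mul]
      exact (mul_le_of_le_one_right hc0 hα0).trans hA
    have t2 : ∑ i, ∑ _p : P, ‖c i‖ * (2 * x ^ 6 / D) ≤ A := by
      simp only [sum_const, card_univ, Fintype.card_coe, nsmul_eq_mul]
      rw [← mul_sum, ← sum_mul]
      have h1 : (#P : ℝ) * (2 * x ^ 6 / D) ≤ 1 := by
        have : (#P : ℝ) * (2 * x ^ 6 / D) = 2 * #P * x ^ 6 / D := by ring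
        rw [this, div_le_one hD0]
        calc 2 * (#P : ℝ) * x ^ 6 ≤ (ρ : ℝ) ^ 4 * x ^ 6 := by gcongr; exact hPcard.1
          _ = (x * ρ) ^ 4 * x ^ 2 := by ring
          _ ≤ D := by rw [hxρ]; nlinarith
      calc (#P : ℝ) * ((∑ i, ‖c i‖) * (2 * x ^ 6 / D)) =
          (∑ i, ‖c i‖) * (#P * (2 * x ^ 6 / D)) := by ring
        _ ≤ ∑ i, ‖c i‖ := mul_le_of_le_one_right hc0 h1
        _ ≤ A := hA
    have t3 : ∑ _m : Y, 2 * x ^ 5 / D ≤ 1 := by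
      simp only [sum_const, card_univ, Fintype.card_coe, nsmul_eq_mul, hYc]
      have : ((ρ ^ 2 : ℕ) : ℝ) * (2 * x ^ 5 / D) = 2 * (x * ρ) ^ 2 * x ^ 3 / D := by
        push_cast
        ring
      rw [this, hxρ, div_le_one hD0]
      have := pow_le_pow_left₀ hx0.le hx2 3
      norm_num at this
      linarith
    linarith
  · rw [Fintype.card_sum, Fintype.card_sum, Fintype.card_prod, Fintype.card_coe, Fintype.card_coe,
      hYc, ← add_assoc]
    gcongr
    exact hPcard.2
  · rw [hsum fun k => (a k : ℂ)]
    set V := (∑ i, c i * (a (n i) : ℂ)).re with hVdef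
    have e1 : |(∑ i, ∑ p ∈ P, c i * (-(2 * x ^ 6 * (τ p.1 * τ p.2)) / D : ℝ) *
        (a (n i + p.1 - p.2) : ℂ)).re| ≤ x ^ 3 * δ / 2 / D := by
      refine (Complex.abs_re_le_norm _).trans ?_
      refine (norm_sum_le _ _).trans ?_
      have h1 : ∀ i, ‖∑ p ∈ P, c i * (-(2 * x ^ 6 * (τ p.1 * τ p.2)) / D : ℝ) *
          (a (n i + p.1 - p.2) : ℂ)‖ ≤ ‖c i‖ * (#P * (2 * x ^ 6 / D * η)) := by
        intro i
        refine (norm_sum_le_of_le P (n := fun _ => ‖c i‖ * (2 * x ^ 6 / D * η)) ?_).trans ?_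
        · intro p hp
          rw [hP, mem_filter, mem_product] at hp
          have := hS' _ (hYn p.1 hp.1.1 p.2 hp.1.2 hp.2 i)
          simp only [norm_mul, Complex.norm_real, Real.norm_eq_abs,
            abs_div, abs_neg, abs_mul, hτ1, abs_of_pos hD0, abs_two, abs_of_pos (pow_pos hx0 _),
            mul_one]
          rw [mul_assoc]
          gcongr
        · rw [sum_const, nsmul_eq_mul]
          exact le_of_eq (by ring)
      refine (sum_le_sum fun i _ => h1 i).trans ?_
      rw [← sum_mul]
      have hA0 : 0 ≤ A := (sum_nonneg fun i _ => norm_nonneg (c i)).trans hA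
      calc (∑ i, ‖c i‖) * (#P * (2 * x ^ 6 / D * η)) ≤ A * (#P * (2 * x ^ 6 / D * η)) := by
            gcongr
        _ = A * x ^ 6 * η / D * (2 * #P) := by ring
        _ ≤ A * x ^ 6 * η / D * (ρ : ℝ) ^ 4 := by gcongr; exact hPcard.1
        _ = x ^ 3 * (2 * ρ * A * η) / 2 / D * (x * ρ) ^ 3 := by ring
        _ ≤ x ^ 3 * δ / 2 / D := by
            rw [hxρ, one_pow, mul_one]
            gcongr
    have e2 : 2 * x ^ 3 * δ / D ≤ (∑ m ∈ Y, ((2 * x ^ 5 * τ m / D : ℝ) : ℂ) * (a m : ℂ)).re := by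
      have h1 : (∑ m ∈ Y, ((2 * x ^ 5 * τ m / D : ℝ) : ℂ) * (a m : ℂ)).re =
          ∑ m ∈ Y, 2 * x ^ 5 / D * |a m| := by
        rw [Complex.re_sum]
        refine sum_congr rfl fun m _ => ?_
        rw [← Complex.ofReal_mul, Complex.ofReal_re, ← hτa]
        ring
      rw [h1, ← mul_sum]
      have h2 : (ρ : ℝ) ^ 2 * δ ≤ ∑ m ∈ Y, |a m| := by
        have := card_nsmul_le_sum Y (fun m => |a m|) δ fun m hm => hS m (hYS m hm).1
        rw [hYc, nsmul_eq_mul] at this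
        exact_mod_cast this
      calc 2 * x ^ 3 * δ / D = 2 * x ^ 3 * (x * ρ) ^ 2 * δ / D := by rw [hxρ]; ring
        _ = 2 * x ^ 5 / D * ((ρ : ℝ) ^ 2 * δ) := by ring
        _ ≤ _ := by gcongr
    rw [Complex.add_re, Complex.add_re, Complex.re_ofReal_mul, ← hVdef, hα1]
    have e3 : V + x ^ 3 * δ / 4 ≤
        (1 - x ^ 4) / D * V - x ^ 3 * δ / 2 / D + 2 * x ^ 3 * δ / D := by
      have h1 : (1 - x ^ 4) / D * V - x ^ 3 * δ / 2 / D + 2 * x ^ 3 * δ / D =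
          ((1 - x ^ 4) * V + 3 / 2 * (x ^ 3 * δ)) / D := by ring
      rw [h1, le_div_iff₀ hD0, hD]
      have h2 : x ^ 4 * V ≤ x ^ 3 * δ / 4 := by
        calc x ^ 4 * V ≤ x ^ 4 * (ρ * δ / 4) := by gcongr
          _ = x ^ 3 * δ / 4 * (x * ρ) := by ring
          _ = x ^ 3 * δ / 4 := by rw [hxρ, mul_one]
      have h3 : x ^ 3 * δ * x ^ 4 ≤ x ^ 3 * δ * (1 / 16) := by gcongr
      have h4 : 0 < x ^ 3 * δ := by positivity
      linarith
    have := neg_le_of_abs_le e1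
    linarith

open Finset in
theorem exists_trigPoly_of_large_coeffs {ρ : ℕ} (hρ : 2 ≤ ρ) {δ C : ℝ} (hδ : 0 < δ)
    (hC : C ≤ ρ * δ / 4) (k : ℕ) :
    ∃ (K u B : ℕ) (A η : ℝ), 0 < η ∧ ∀ (a : ℤ → ℝ) (S : Finset ℤ),
      (∀ (ι : Type) (_ : Fintype ι) (c : ι → ℂ) (n : ι → ℤ),
        (∀ z : ℂ, ‖z‖ = 1 → ‖∑ i, c i * z ^ n i‖ ≤ 1) → (∑ i, c i * a (n i)).re ≤ C) →
      (∀ m ∈ S, δ ≤ |a m|) → (∀ m ∉ S, |a m| ≤ η) → B ≤ #S →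
      ∃ (ι : Type) (_ : Fintype ι) (c : ι → ℂ) (n : ι → ℤ),
        (∀ z : ℂ, ‖z‖ = 1 → ‖∑ i, c i * z ^ n i‖ ≤ 1) ∧ (∀ i, #{s ∈ S | n i < s} ≤ u) ∧
        ∑ i, ‖c i‖ ≤ A ∧ Fintype.card ι ≤ K ∧
        k * ((ρ : ℝ)⁻¹ ^ 3 * δ / 4) ≤ (∑ i, c i * a (n i)).re := by
  induction k with
  | zero =>
    refine ⟨0, 0, 0, 0, 1, one_pos, fun a S _ _ _ _ => ⟨Fin 0, inferInstance, fun _ => 0,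
      fun _ => 0, ?_⟩⟩
    simp
  | succ k ih =>
    obtain ⟨K, u, B, A, η, hη, h⟩ := ih
    have hρ0 : (0 : ℝ) < ρ := by
      have : 0 < ρ := by omega
      exact_mod_cast this
    have hden : 0 < 2 * ρ * (|A| + 1) := by positivity
    refine ⟨K + K * ρ ^ 4 + ρ ^ 2, max u (ρ ^ 2 * (K * u + 1)), max B (ρ ^ 2 * (K * u + 1)),
      2 * A + 1, min η (δ / (2 * ρ * (|A| + 1))), by positivity, fun a S hH hS hS' hB => ?_⟩
    obtain ⟨ι, hι, c, n, h1, h2, h3, h4, h5⟩ := h a S hH hS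
      (fun m hm => (hS' m hm).trans (min_le_left _ _)) ((le_max_left _ _).trans hB)
    have hle : ρ ^ 2 * (Fintype.card ι * u + 1) ≤ ρ ^ 2 * (K * u + 1) := by gcongr
    obtain ⟨ι', hι', c', n', g1, g2, g3, g4, g5⟩ := exists_improved_trigPoly hρ hδ h1 h2 h3 hS
      (η := min η (δ / (2 * ρ * (|A| + 1)))) (by positivity) hS' (by
        have hmin := min_le_right η (δ / (2 * ρ * (|A| + 1)))
        have hpos : 0 < min η (δ / (2 * ρ * (|A| + 1))) := by positivity
        rw [le_div_iff₀ hden] at hmin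
        have := le_abs_self A
        nlinarith [mul_pos hρ0 hpos]) ((hH ι hι c n h1).trans hC)
      (hle.trans ((le_max_right _ _).trans hB))
    refine ⟨ι', hι', c', n', g1, fun i => (g2 i).trans (max_le_max le_rfl hle), g3, g4.trans ?_, ?_⟩
    · gcongr
    · push_cast
      linarith

open Finset in
theorem exists_card_large_coeffs_le (C : ℝ) {δ : ℝ} (hδ : 0 < δ) :
    ∃ (B : ℕ) (η : ℝ), 0 < η ∧ ∀ (a : ℤ → ℝ) (S : Finset ℤ),
      (∀ (ι : Type) (_ : Fintype ι) (c : ι → ℂ) (n : ι → ℤ),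
        (∀ z : ℂ, ‖z‖ = 1 → ‖∑ i, c i * z ^ n i‖ ≤ 1) → (∑ i, c i * a (n i)).re ≤ C) →
      (∀ m ∈ S, δ ≤ |a m|) → (∀ m ∉ S, |a m| ≤ η) → #S ≤ B := by
  obtain ⟨ρ₀, hρ₀⟩ := exists_nat_ge (C * 4 / δ)
  set ρ := ρ₀ + 2 with hρ
  have hC : C ≤ ρ * δ / 4 := by
    rw [div_le_iff₀ hδ] at hρ₀
    rw [hρ]
    push_cast
    linarith
  have hg : 0 < (ρ : ℝ)⁻¹ ^ 3 * δ / 4 := by positivity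
  obtain ⟨k, hk⟩ := exists_nat_gt (C / ((ρ : ℝ)⁻¹ ^ 3 * δ / 4))
  rw [div_lt_iff₀ hg] at hk
  obtain ⟨K, u, B, A, η, hη, h⟩ := exists_trigPoly_of_large_coeffs (ρ := ρ) (by omega) hδ hC k
  refine ⟨B, η, hη, fun a S hH hS hS' => ?_⟩
  by_contra! hB
  obtain ⟨ι, hι, c, n, h1, -, -, -, h2⟩ := h a S hH hS hS' hB.le
  linarith [hH ι hι c n h1]

open Finset in
theorem Finset.sum_Icc_shift {R : Type*} [CommRing R] {p : ℤ → R} {m : ℕ}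
    (hp : ∀ k : ℤ, m < k.natAbs → p k = 0) {s : ℤ} (hs : s.natAbs ≤ 1) (g : ℤ → R) :
    ∑ k ∈ Icc (-((m : ℤ) + 1)) (m + 1), p (k - s) * g k =
      ∑ k ∈ Icc (-(m : ℤ)) m, p k * g (k + s) := by
  symm
  refine sum_of_injOn (fun k => k + s) (fun _ _ _ _ h => by simpa using h) ?_ ?_ ?_
  · intro k hk
    simp only [coe_Icc, Set.mem_Icc] at hk ⊢
    omega
  · intro k _ hk
    rw [hp, zero_mul]
    by_contra! h
    exact hk ⟨k - s, by simp only [coe_Icc, Set.mem_Icc]; omega, by simp⟩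
  · intro k _
    rw [add_sub_cancel_right]

open Finset in
theorem exists_coeffs_prod_re_sub (R : Multiset ℝ) (hR : ∀ r ∈ R, |r| ≤ 1) :
    ∃ p : ℤ → ℝ, (∀ k : ℤ, R.card < k.natAbs → p k = 0) ∧ p R.card = (1 / 2) ^ R.card ∧
      ∑ k ∈ Icc (-(R.card : ℤ)) R.card, |p k| ≤ 2 ^ R.card ∧
      ∀ z : ℂ, ‖z‖ = 1 → (((R.map fun r => z.re - r).prod : ℝ) : ℂ) =
        ∑ k ∈ Icc (-(R.card : ℤ)) R.card, (p k : ℂ) * z ^ k := by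
  induction R using Multiset.induction with
  | empty =>
    refine ⟨fun k => if k = 0 then 1 else 0, ?_, ?_, ?_, ?_⟩
    · intro k hk
      simp only [Multiset.card_zero] at hk
      exact if_neg (by omega)
    all_goals simp
  | cons r R ih =>
    obtain ⟨p, hp0, hp1, hp2, hp3⟩ := ih fun s hs => hR s (Multiset.mem_cons_of_mem hs)
    have hr := hR r (Multiset.mem_cons_self r R)
    set m := R.card with hm
    rw [Multiset.card_cons, ← hm]
    have habs : ∀ k : ℤ, m < k.natAbs → |p k| = 0 := fun k hk => by rw [hp0 k hk, abs_zero]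
    refine ⟨fun k => 1 / 2 * p (k - 1) + 1 / 2 * p (k - -1) - r * p (k - 0), ?_, ?_, ?_, ?_⟩
    · intro k hk
      simp only
      rw [hp0 (k - 1) (by omega), hp0 (k - -1) (by omega), hp0 (k - 0) (by omega)]
      ring
    · simp only
      push_cast
      rw [add_sub_cancel_right, hp1, hp0 (m + 1 - -1) (by omega), hp0 (m + 1 - 0) (by omega)]
      ring
    · push_cast
      have h1 := Finset.sum_Icc_shift habs (s := 1) (by norm_num) fun _ => 1
      have h2 := Finset.sum_Icc_shift habs (s := -1) (by norm_num) fun _ => 1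
      have h3 := Finset.sum_Icc_shift habs (s := 0) (by norm_num) fun _ => 1
      simp only [mul_one] at h1 h2 h3
      calc ∑ k ∈ Icc (-((m : ℤ) + 1)) (m + 1),
            |1 / 2 * p (k - 1) + 1 / 2 * p (k - -1) - r * p (k - 0)| ≤
          ∑ k ∈ Icc (-((m : ℤ) + 1)) (m + 1),
            (1 / 2 * |p (k - 1)| + 1 / 2 * |p (k - -1)| + |p (k - 0)|) := by
            refine sum_le_sum fun k _ => ?_
            refine (abs_sub _ _).trans ?_
            refine add_le_add ((abs_add_le _ _).trans (le_of_eq ?_)) ?_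
            · rw [abs_mul, abs_mul, abs_of_pos (by norm_num : (0 : ℝ) < 1 / 2)]
            · rw [abs_mul]
              exact mul_le_of_le_one_left (abs_nonneg _) hr
        _ = 2 * ∑ k ∈ Icc (-(m : ℤ)) m, |p k| := by
            rw [sum_add_distrib, sum_add_distrib, ← mul_sum, ← mul_sum, h1, h2, h3]
            ring
        _ ≤ 2 ^ (m + 1) := by
            rw [pow_succ']
            gcongr
    · intro z hz
      have hz0 : z ≠ 0 := by
        rintro rfl
        simp at hz
      have hpC : ∀ k : ℤ, m < k.natAbs → (p k : ℂ) = 0 := fun k hk => by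
        rw [hp0 k hk, Complex.ofReal_zero]
      have h1 := Finset.sum_Icc_shift hpC (s := 1) (by norm_num) fun k => z ^ k
      have h2 := Finset.sum_Icc_shift hpC (s := -1) (by norm_num) fun k => z ^ k
      have h3 := Finset.sum_Icc_shift hpC (s := 0) (by norm_num) fun k => z ^ k
      have hre : (z.re : ℂ) = (z + z⁻¹) / 2 := by
        rw [Complex.re_eq_add_conj, ← Complex.inv_eq_conj hz]
      rw [Multiset.map_cons, Multiset.prod_cons, Complex.ofReal_mul, hp3 z hz, Complex.ofReal_sub,
        hre]
      push_cast
      simp only [sub_mul, add_mul, mul_assoc, sum_sub_distrib, sum_add_distrib, ← mul_sum]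
      rw [h1, h2, h3]
      simp only [zpow_add₀ hz0, zpow_one, zpow_neg_one, zpow_zero, ← mul_assoc, ← sum_mul]
      ring

open Finset in
theorem Finset.sum_Icc_neg_eq {R : Type*} [AddCommMonoid R] (N : ℕ) (g : ℤ → R) :
    ∑ j ∈ Icc (-(N : ℤ)) N, g j = g 0 + ∑ n ∈ range N, (g (n + 1) + g (-(n + 1))) := by
  induction N with
  | zero => simp
  | succ N ih =>
    have h : Icc (-((N + 1 : ℕ) : ℤ)) ((N + 1 : ℕ) : ℤ) =
        insert ((N : ℤ) + 1) (insert (-((N : ℤ) + 1)) (Icc (-(N : ℤ)) N)) := by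
      ext j
      simp only [mem_Icc, mem_insert]
      omega
    rw [h, sum_insert (by simp only [mem_Icc, mem_insert]; omega),
      sum_insert (by simp only [mem_Icc]; omega), ih, sum_range_succ]
    ac_rfl

/-- The Fourier coefficients of the cosine polynomial with coefficients `ε 0, …, ε N`. -/
noncomputable def cosCoeff (ε : ℕ → ℝ) (N : ℕ) (j : ℤ) : ℝ :=
  if j.natAbs ≤ N then if j = 0 then ε 0 else ε j.natAbs / 2 else 0

theorem cosCoeff_neg (ε : ℕ → ℝ) (N : ℕ) (j : ℤ) : cosCoeff ε N (-j) = cosCoeff ε N j := by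
  simp [cosCoeff]

theorem cosCoeff_eq_zero {ε : ℕ → ℝ} {N : ℕ} {j : ℤ} (hj : N < j.natAbs) :
    cosCoeff ε N j = 0 := by
  rw [cosCoeff, if_neg hj.not_ge]

theorem cosCoeff_natCast {ε : ℕ → ℝ} {N n : ℕ} (hn : 0 < n) (hN : n ≤ N) :
    cosCoeff ε N n = ε n / 2 := by
  rw [cosCoeff, if_pos (by simpa using hN), if_neg (by omega), Int.natAbs_natCast]

theorem abs_cosCoeff_le {ε : ℕ → ℝ} {N : ℕ} (hε : ∀ n ≤ N, ε n = 1 ∨ ε n = -1) (j : ℤ) :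
    |cosCoeff ε N j| ≤ 1 := by
  have h : ∀ n ≤ N, |ε n| = 1 := fun n hn => by
    rcases hε n hn with h | h <;> simp [h]
  rw [cosCoeff]
  split_ifs with h1 h2
  · exact (h 0 (Nat.zero_le _)).le
  · rw [abs_div, h _ h1]
    norm_num
  · simp

open Finset in
theorem sum_cos_eq_sum_cosCoeff (ε : ℕ → ℝ) (N : ℕ) (θ : ℝ) :
    ((∑ n ∈ range (N + 1), ε n * Real.cos (n * θ) : ℝ) : ℂ) =
      ∑ j ∈ Icc (-(N : ℤ)) N, (cosCoeff ε N j : ℂ) * Complex.exp (θ * Complex.I) ^ j := by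
  rw [Finset.sum_Icc_neg_eq, sum_range_succ', add_comm]
  push_cast
  congr 1
  · simp [cosCoeff]
  · refine sum_congr rfl fun n hn => ?_
    rw [mem_range] at hn
    have h := cosCoeff_natCast (ε := ε) (N := N) (n := n + 1) (by omega) (by omega)
    push_cast at h
    rw [cosCoeff_neg, h, Complex.cos, ← Complex.exp_int_mul, ← Complex.exp_int_mul]
    push_cast
    have e1 : ((n : ℂ) + 1) * (θ * Complex.I) = (n + 1) * θ * Complex.I := by ring
    have e2 : -((n : ℂ) + 1) * (θ * Complex.I) = -((n + 1) * θ) * Complex.I := by ring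
    rw [e1, e2]
    ring

theorem integral_exp_zpow (k : ℤ) :
    ∫ θ in (0 : ℝ)..2 * Real.pi, Complex.exp (θ * Complex.I) ^ k =
      if k = 0 then (2 * Real.pi : ℂ) else 0 := by
  split_ifs with hk
  · simp [hk]
  · have h : ∀ θ : ℝ, Complex.exp (θ * Complex.I) ^ k = Complex.exp (k * Complex.I * θ) :=
      fun θ => by
        rw [← Complex.exp_int_mul]
        ring_nf
    simp only [h]
    rw [integral_exp_mul_complex (mul_ne_zero (by exact_mod_cast hk) Complex.I_ne_zero)]
    have h2 : (k : ℂ) * Complex.I * ((2 * Real.pi : ℝ) : ℂ) = k * (2 * Real.pi * Complex.I) := by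
      push_cast
      ring
    rw [h2, Complex.exp_int_mul_two_pi_mul_I]
    simp

open Polynomial in
theorem Polynomial.exists_mul_prod_sub_nonneg (P : ℝ[X]) (hP : P ≠ 0) :
    ∃ R : Finset ℝ, (∀ r ∈ R, P.IsRoot r ∧ r ∈ Set.Icc (-1 : ℝ) 1) ∧ ∃ σ : ℝ, (σ = 1 ∨ σ = -1) ∧
      ∀ x ∈ Set.Icc (-1 : ℝ) 1, 0 ≤ σ * P.eval x * ∏ r ∈ R, (x - r) := by
  classical
  induction hn : P.natDegree using Nat.strong_induction_on generalizing P with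
  | _ n ih =>
    by_cases hroot : ∃ r ∈ Set.Icc (-1 : ℝ) 1, P.IsRoot r
    · obtain ⟨r, hr, hPr⟩ := hroot
      obtain ⟨Q, rfl⟩ := dvd_iff_isRoot.2 hPr
      have hQ : Q ≠ 0 := right_ne_zero_of_mul hP
      have hdeg : Q.natDegree < n := by
        rw [← hn, natDegree_mul (X_sub_C_ne_zero r) hQ, natDegree_X_sub_C]
        omega
      obtain ⟨R, hR, σ, hσ, h⟩ := ih _ hdeg Q hQ rfl
      by_cases hrR : r ∈ R
      · refine ⟨R.erase r, fun s hs => ⟨?_, (hR s (Finset.mem_of_mem_erase hs)).2⟩, σ, hσ,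
          fun x hx => ?_⟩
        · exact root_mul_left_of_isRoot _ (hR s (Finset.mem_of_mem_erase hs)).1
        · have := h x hx
          rw [← Finset.mul_prod_erase R _ hrR] at this
          rw [eval_mul, eval_sub, eval_X, eval_C]
          linarith
      · refine ⟨insert r R, fun s hs => ?_, σ, hσ, fun x hx => ?_⟩
        · rcases Finset.mem_insert.1 hs with rfl | hs
          · exact ⟨hPr, hr⟩
          · exact ⟨root_mul_left_of_isRoot _ (hR s hs).1, (hR s hs).2⟩
        · rw [Finset.prod_insert hrR, eval_mul, eval_sub, eval_X, eval_C]
          have := mul_nonneg (h x hx) (sq_nonneg (x - r))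
          linarith
    · push Not at hroot
      have hpos : ∀ σ : ℝ, 0 < σ * P.eval 0 → ∀ x ∈ Set.Icc (-1 : ℝ) 1, 0 ≤ σ * P.eval x := by
        intro σ h0 x hx
        by_contra! hneg
        have hc : ContinuousOn (fun y => σ * P.eval y) (Set.Icc (-1 : ℝ) 1) := by fun_prop
        obtain ⟨y, hy, hy0⟩ := isPreconnected_Icc.intermediate_value hx
          (show (0 : ℝ) ∈ Set.Icc (-1 : ℝ) 1 by constructor <;> norm_num) hc
          ⟨hneg.le, h0.le⟩
        rcases mul_eq_zero.1 hy0 with h | h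
        · rw [h, zero_mul] at h0
          exact lt_irrefl _ h0
        · exact hroot y hy h
      have h0 : P.eval 0 ≠ 0 := hroot 0 (by constructor <;> norm_num)
      rcases lt_or_gt_of_ne h0 with h | h
      · exact ⟨∅, by simp, -1, Or.inr rfl, by simpa using hpos (-1) (by linarith)⟩
      · exact ⟨∅, by simp, 1, Or.inl rfl, by simpa using hpos 1 (by linarith)⟩

open Polynomial in
/-- The polynomial `P` with `P (cos θ) = ∑ ε n cos (n θ)`. -/
noncomputable def cosPoly (ε : ℕ → ℝ) (N : ℕ) : ℝ[X] :=
  ∑ n ∈ Finset.range (N + 1), C (ε n) * Chebyshev.T ℝ n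

theorem cosPoly_eval_cos (ε : ℕ → ℝ) (N : ℕ) (θ : ℝ) : (cosPoly ε N).eval (Real.cos θ) =
    ∑ n ∈ Finset.range (N + 1), ε n * Real.cos (n * θ) := by
  rw [cosPoly, Polynomial.eval_finsetSum]
  refine Finset.sum_congr rfl fun n _ => ?_
  rw [Polynomial.eval_mul, Polynomial.eval_C, Polynomial.Chebyshev.T_real_cos, Int.cast_natCast]

theorem cosPoly_ne_zero {ε : ℕ → ℝ} {N : ℕ} (h : ε N ≠ 0) : cosPoly ε N ≠ 0 := by
  intro h0
  have h1 := congrArg (fun P => Polynomial.coeff P N) h0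
  simp only [cosPoly, Polynomial.finsetSum_coeff, Polynomial.coeff_C_mul,
    Polynomial.coeff_zero] at h1
  rw [Finset.sum_range_succ, Finset.sum_eq_zero, zero_add] at h1
  · rcases mul_eq_zero.1 h1 with h2 | h2
    · exact h h2
    · have h3 : (Polynomial.Chebyshev.T ℝ N).leadingCoeff ≠ 0 := by
        rw [Polynomial.Chebyshev.leadingCoeff_T]
        positivity
      rw [Polynomial.leadingCoeff, Polynomial.Chebyshev.natDegree_T, Int.natAbs_natCast] at h3
      exact h3 h2
  · intro n hn
    rw [Polynomial.coeff_eq_zero_of_natDegree_lt, mul_zero]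
    rw [Polynomial.Chebyshev.natDegree_T, Int.natAbs_natCast]
    exact Finset.mem_range.1 hn

theorem finite_cos_sum_zeros {ε : ℕ → ℝ} {N : ℕ} (h : ε N ≠ 0) :
    {θ : ℝ | θ ∈ Set.Icc 0 (2 * Real.pi) ∧
      ∑ n ∈ Finset.range (N + 1), ε n * Real.cos (n * θ) = 0}.Finite := by
  set Z := ((cosPoly ε N).roots.toFinset : Set ℝ) with hZ
  refine ((Z.toFinite.image Real.arccos).union
    (Z.toFinite.image fun x => 2 * Real.pi - Real.arccos x)).subset ?_
  rintro θ ⟨⟨h0, h1⟩, hθ⟩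
  rw [← cosPoly_eval_cos] at hθ
  have hmem : Real.cos θ ∈ Z := by
    rw [hZ, Finset.mem_coe, Multiset.mem_toFinset, Polynomial.mem_roots (cosPoly_ne_zero h)]
    exact hθ
  rcases le_total θ Real.pi with hle | hle
  · exact Or.inl ⟨_, hmem, Real.arccos_cos h0 hle⟩
  · refine Or.inr ⟨_, hmem, ?_⟩
    simp only
    rw [← Real.cos_two_pi_sub, Real.arccos_cos (by linarith) (by linarith), sub_sub_cancel]

open Finset in
theorem integral_cos_sum_mul_prod_mul_zpow {ε : ℕ → ℝ} {N d : ℕ} {R : Multiset ℝ} {p : ℤ → ℝ}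
    (hp : ∀ z : ℂ, ‖z‖ = 1 → (((R.map fun r => z.re - r).prod : ℝ) : ℂ) =
        ∑ k ∈ Icc (-(d : ℤ)) d, (p k : ℂ) * z ^ k) (m : ℤ) :
    ∫ θ in (0 : ℝ)..2 * Real.pi, (((∑ n ∈ range (N + 1), ε n * Real.cos (n * θ)) *
      (R.map fun r => Real.cos θ - r).prod : ℝ) : ℂ) * Complex.exp (θ * Complex.I) ^ m =
      2 * Real.pi * ((∑ k ∈ Icc (-(d : ℤ)) d, p k * cosCoeff ε N (m + k) : ℝ) : ℂ) := by
  have h : ∀ θ : ℝ, (((∑ n ∈ range (N + 1), ε n * Real.cos (n * θ)) *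
      (R.map fun r => Real.cos θ - r).prod : ℝ) : ℂ) * Complex.exp (θ * Complex.I) ^ m =
      ∑ k ∈ Icc (-(d : ℤ)) d, ∑ j ∈ Icc (-(N : ℤ)) N, (p k : ℂ) * (cosCoeff ε N j *
        Complex.exp (θ * Complex.I) ^ (j + k + m)) := by
    intro θ
    have h1 := hp (Complex.exp (θ * Complex.I)) (Complex.norm_exp_ofReal_mul_I θ)
    rw [Complex.exp_ofReal_mul_I_re] at h1
    rw [Complex.ofReal_mul, sum_cos_eq_sum_cosCoeff, h1, mul_comm (∑ j ∈ _, _) (∑ k ∈ _, _),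
      sum_mul_sum, sum_mul]
    refine sum_congr rfl fun k _ => ?_
    rw [sum_mul]
    refine sum_congr rfl fun j _ => ?_
    rw [zpow_add₀ (Complex.exp_ne_zero _), zpow_add₀ (Complex.exp_ne_zero _)]
    ring
  have hc : ∀ k : ℤ, Continuous fun θ : ℝ => Complex.exp (θ * Complex.I) ^ k := fun k => by
    simp only [← Complex.exp_int_mul]
    fun_prop
  simp only [h]
  rw [intervalIntegral.integral_finsetSum fun k _ => by
    refine Continuous.intervalIntegrable (continuous_finsetSum _ fun j _ => ?_) _ _
    exact continuous_const.mul (continuous_const.mul (hc _))]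
  push_cast
  rw [mul_sum]
  refine sum_congr rfl fun k _ => ?_
  rw [intervalIntegral.integral_finsetSum fun j _ => by
    refine Continuous.intervalIntegrable ?_ _ _
    exact continuous_const.mul (continuous_const.mul (hc _))]
  simp only [intervalIntegral.integral_const_mul, integral_exp_zpow]
  rw [← mul_sum, sum_eq_single (-(m + k))]
  · rw [cosCoeff_neg, if_pos (by ring)]
    ring
  · intro j _ hj
    rw [if_neg (by omega), mul_zero]
  · intro hj
    rw [cosCoeff_eq_zero, Complex.ofReal_zero, zero_mul]
    rw [mem_Icc] at hj
    omega

open Finset in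
theorem exists_bounded_correlation {d N : ℕ} {ε : ℕ → ℝ} (hε : ∀ n ≤ N, ε n = 1 ∨ ε n = -1)
    (hd : {θ : ℝ | θ ∈ Set.Icc 0 (2 * Real.pi) ∧
      ∑ n ∈ range (N + 1), ε n * Real.cos (n * θ) = 0}.ncard ≤ d) :
    ∃ p : ℤ → ℝ, p d = (1 / 2) ^ d ∧
      ∀ (ι : Type) (_ : Fintype ι) (c : ι → ℂ) (n : ι → ℤ),
        (∀ z : ℂ, ‖z‖ = 1 → ‖∑ i, c i * z ^ n i‖ ≤ 1) →
        (∑ i, c i * ((∑ k ∈ Icc (-(d : ℤ)) d, p k * cosCoeff ε N (n i + k) : ℝ) : ℂ)).re ≤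
          2 ^ d := by
  have hN : ε N ≠ 0 := by rcases hε N le_rfl with h | h <;> simp [h]
  have hfin := finite_cos_sum_zeros hN
  obtain ⟨R₀, hR₀, σ, hσ, hsign⟩ :=
    (cosPoly ε N).exists_mul_prod_sub_nonneg (cosPoly_ne_zero hN)
  have hcard : #R₀ ≤ d := by
    refine le_trans ?_ hd
    rw [← Set.ncard_coe_finset]
    refine Set.ncard_le_ncard_of_injOn Real.arccos ?_ ?_ hfin
    · intro r hr
      obtain ⟨h1, h2, h3⟩ := hR₀ r hr
      refine ⟨⟨Real.arccos_nonneg r, ?_⟩, ?_⟩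
      · linarith [Real.arccos_le_pi r, Real.pi_pos]
      · rw [← cosPoly_eval_cos, Real.cos_arccos h2 h3]
        exact h1
    · exact Real.arccos_injOn.mono fun r hr => (hR₀ r hr).2
  set R : Multiset ℝ := R₀.val + Multiset.replicate (d - #R₀) (-1) with hRdef
  have hRcard : R.card = d := by
    rw [hRdef, Multiset.card_add, Multiset.card_replicate, Finset.card_val]
    omega
  obtain ⟨p, -, hp1, hp2, hp3⟩ := exists_coeffs_prod_re_sub R (by
    intro r hr
    rcases Multiset.mem_add.1 hr with h | h
    · exact abs_le.2 (hR₀ r h).2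
    · rw [Multiset.eq_of_mem_replicate h]
      norm_num)
  rw [hRcard] at hp1 hp2 hp3
  refine ⟨p, hp1, fun ι _ c n hΦ => ?_⟩
  set F : ℝ → ℝ := fun θ => (∑ n ∈ range (N + 1), ε n * Real.cos (n * θ)) *
      (R.map fun r => Real.cos θ - r).prod with hF
  have h_coeff := fun m => integral_cos_sum_mul_prod_mul_zpow (ε := ε) (N := N) hp3 m
  have hFsign : ∀ θ, 0 ≤ σ * F θ := by
    intro θ
    have h1 := hsign (Real.cos θ) ⟨Real.neg_one_le_cos θ, Real.cos_le_one θ⟩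
    have h2 : 0 ≤ (Real.cos θ - -1) ^ (d - #R₀) :=
      pow_nonneg (by linarith [Real.neg_one_le_cos θ]) _
    rw [cosPoly_eval_cos] at h1
    have h3 := mul_nonneg h1 h2
    rw [hF, hRdef]
    simp only [Multiset.map_add, Multiset.prod_add, Multiset.map_replicate,
      Multiset.prod_replicate]
    calc _ ≤ _ := h3
      _ = _ := by
        rw [Finset.prod_eq_multiset_prod]
        ring
  have hFcont : Continuous F := by
    have : Continuous fun θ => (R.map fun r => Real.cos θ - r).prod :=
      continuous_multiset_prod R fun r _ => by fun_prop
    rw [hF]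
    fun_prop
  have hσabs : ∀ y : ℝ, 0 ≤ σ * y → |y| = σ * y := by
    intro y hy
    rcases hσ with rfl | rfl
    · rw [one_mul] at hy ⊢
      exact abs_of_nonneg hy
    · rw [neg_one_mul] at hy ⊢
      exact abs_of_nonpos (by linarith)
  have hmass : ∫ θ in (0 : ℝ)..2 * Real.pi, |F θ| ≤ 2 * Real.pi * 2 ^ d := by
    have h1 : ∫ θ in (0 : ℝ)..2 * Real.pi, |F θ| = σ * ∫ θ in (0 : ℝ)..2 * Real.pi, F θ := by
      rw [← intervalIntegral.integral_const_mul]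
      exact intervalIntegral.integral_congr fun θ _ => hσabs _ (hFsign θ)
    have h2 : ∫ θ in (0 : ℝ)..2 * Real.pi, F θ =
        2 * Real.pi * ∑ k ∈ Icc (-(d : ℤ)) d, p k * cosCoeff ε N (0 + k) := by
      have := h_coeff 0
      simp only [zpow_zero, mul_one] at this
      rw [intervalIntegral.integral_ofReal] at this
      exact_mod_cast this
    have h3 : |∑ k ∈ Icc (-(d : ℤ)) d, p k * cosCoeff ε N (0 + k)| ≤ 2 ^ d := by
      refine (abs_sum_le_sum_abs _ _).trans (le_trans (sum_le_sum fun k _ => ?_) hp2)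
      rw [abs_mul]
      exact mul_le_of_le_one_right (abs_nonneg _) (abs_cosCoeff_le hε _)
    have h4 : |σ| = 1 := by rcases hσ with rfl | rfl <;> norm_num
    rw [h1, h2]
    refine (le_abs_self _).trans ?_
    rw [abs_mul, h4, one_mul, abs_mul, abs_of_pos Real.two_pi_pos]
    gcongr
  have hc : ∀ k : ℤ, Continuous fun θ : ℝ => Complex.exp (θ * Complex.I) ^ k := fun k => by
    simp only [← Complex.exp_int_mul]
    fun_prop
  have htotal : ∫ θ in (0 : ℝ)..2 * Real.pi, (F θ : ℂ) *
      ∑ i, c i * Complex.exp (θ * Complex.I) ^ n i =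
      2 * Real.pi * ∑ i, c i *
        ((∑ k ∈ Icc (-(d : ℤ)) d, p k * cosCoeff ε N (n i + k) : ℝ) : ℂ) := by
    have h1 : ∀ θ : ℝ, (F θ : ℂ) * ∑ i, c i * Complex.exp (θ * Complex.I) ^ n i =
        ∑ i, c i * ((F θ : ℂ) * Complex.exp (θ * Complex.I) ^ n i) := fun θ => by
      rw [mul_sum]
      exact sum_congr rfl fun i _ => by ring
    simp only [h1]
    rw [intervalIntegral.integral_finsetSum fun i _ => by
      refine Continuous.intervalIntegrable ?_ _ _
      exact continuous_const.mul ((Complex.continuous_ofReal.comp hFcont).mul (hc _)), mul_sum]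
    refine sum_congr rfl fun i _ => ?_
    rw [intervalIntegral.integral_const_mul, h_coeff]
    ring
  have hbound : ‖∫ θ in (0 : ℝ)..2 * Real.pi, (F θ : ℂ) *
      ∑ i, c i * Complex.exp (θ * Complex.I) ^ n i‖ ≤ 2 * Real.pi * 2 ^ d := by
    refine le_trans ?_ hmass
    refine intervalIntegral.norm_integral_le_of_norm_le Real.two_pi_pos.le
      (Filter.Eventually.of_forall fun θ _ => ?_) (hFcont.abs.intervalIntegrable _ _)
    rw [norm_mul, Complex.norm_real, Real.norm_eq_abs]
    exact mul_le_of_le_one_right (abs_nonneg _) (hΦ _ (Complex.norm_exp_ofReal_mul_I θ))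
  rw [htotal, norm_mul] at hbound
  have h2π : ‖(2 * Real.pi : ℂ)‖ = 2 * Real.pi := by
    have : (2 * Real.pi : ℂ) = ((2 * Real.pi : ℝ) : ℂ) := by push_cast; rfl
    rw [this, Complex.norm_real, Real.norm_of_nonneg Real.two_pi_pos.le]
  rw [h2π] at hbound
  exact (Complex.re_le_norm _).trans (le_of_mul_le_mul_left hbound Real.two_pi_pos)

open Finset in
theorem card_abs_correlation_le (d N : ℕ) {ε : ℕ → ℝ} (hε : ∀ n ≤ N, ε n = 1 ∨ ε n = -1)
    (p : ℤ → ℝ) : ∃ V : Finset ℝ, #V ≤ 5 ^ (2 * d + 1) ∧ ∀ n : ℤ,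
      |∑ k ∈ Icc (-(d : ℤ)) d, p k * cosCoeff ε N (n + k)| ∈ V := by
  classical
  set T : Finset ℝ := {0, 1, -1, 1 / 2, -1 / 2} with hT
  have hbT : ∀ j, cosCoeff ε N j ∈ T := by
    intro j
    rw [cosCoeff]
    split_ifs with h1 h2
    · rcases hε 0 (Nat.zero_le _) with h | h <;> simp [hT, h]
    · rcases hε _ h1 with h | h <;> simp [hT, h]
    · simp [hT]
  refine ⟨(Fintype.piFinset fun _ : Icc (-(d : ℤ)) d => T).image
    fun w => |∑ k : Icc (-(d : ℤ)) d, p k * w k|, ?_, fun n => ?_⟩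
  · refine card_image_le.trans ?_
    rw [Fintype.card_piFinset, prod_const, card_univ, Fintype.card_coe, Int.card_Icc]
    have h1 : ((d : ℤ) + 1 - -(d : ℤ)).toNat = 2 * d + 1 := by omega
    rw [h1]
    exact Nat.pow_le_pow_left card_le_five _
  · refine mem_image.2 ⟨fun k => cosCoeff ε N (n + k), ?_, ?_⟩
    · exact Fintype.mem_piFinset.2 fun k => hbT _
    · congr 1
      exact sum_coe_sort (Icc (-(d : ℤ)) d) fun k => p k * cosCoeff ε N (n + k)

theorem exists_gap {δ : ℕ → ℝ} (hδ : Antitone δ) {V : Finset ℝ} {K : ℕ} (hV : V.card ≤ K) :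
    ∃ j ≤ K, ∀ v ∈ V, δ j ≤ v ∨ v ≤ δ (j + 1) := by
  by_contra! h
  choose! v hvV hv1 hv2 using h
  have hinj : Set.InjOn v (Finset.range (K + 1)) := by
    intro i hi j hj hij
    rw [Finset.mem_coe, Finset.mem_range] at hi hj
    by_contra hne
    rcases lt_or_gt_of_ne hne with hlt | hlt
    · have := hδ (show i + 1 ≤ j by omega)
      linarith [hv2 i (by omega), hv1 j (by omega)]
    · have := hδ (show j + 1 ≤ i by omega)
      linarith [hv2 j (by omega), hv1 i (by omega)]
  have := Finset.card_le_card_of_injOn v (t := V) (fun i hi => hvV i (by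
    have := Finset.mem_range.1 hi
    omega)) hinj
  rw [Finset.card_range] at this
  omega

open Finset in
theorem exists_card_exceptional_le (d : ℕ) : ∃ B : ℕ, ∀ (N : ℕ) (ε : ℕ → ℝ),
    (∀ n ≤ N, ε n = 1 ∨ ε n = -1) →
    {θ : ℝ | θ ∈ Set.Icc 0 (2 * Real.pi) ∧
      ∑ n ∈ range (N + 1), ε n * Real.cos (n * θ) = 0}.ncard ≤ d →
    ∃ S : Finset ℤ, #S ≤ B ∧ ∀ n ∉ S, ∀ m ∉ S,
      (∀ k : ℤ, -d ≤ k → k < d → cosCoeff ε N (n + k) = cosCoeff ε N (m + k)) →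
      |cosCoeff ε N (n + d) - cosCoeff ε N (m + d)| < 1 := by
  classical
  choose! Bf ηf hηf hcard using fun (δ : ℝ) (hδ : 0 < δ) => exists_card_large_coeffs_le (2 ^ d) hδ
  set K := 5 ^ (2 * d + 1) with hK
  obtain ⟨δ, hδ0, hδs⟩ : ∃ δ : ℕ → ℝ, δ 0 = (1 / 2) ^ (d + 1) ∧
      ∀ j, δ (j + 1) = min (δ j) (ηf (δ j)) :=
    ⟨fun j => Nat.rec ((1 / 2) ^ (d + 1)) (fun _ x => min x (ηf x)) j, rfl, fun _ => rfl⟩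
  have hδpos : ∀ j, 0 < δ j := by
    intro j
    induction j with
    | zero =>
      rw [hδ0]
      positivity
    | succ j ih =>
      rw [hδs]
      exact lt_min ih (hηf _ ih)
  have hδanti : Antitone δ := antitone_nat_of_succ_le fun j => by
    rw [hδs]
    exact min_le_left _ _
  refine ⟨(range (K + 1)).sup fun j => Bf (δ j), fun N ε hε hd => ?_⟩
  obtain ⟨p, hp, hH⟩ := exists_bounded_correlation hε hd
  set a : ℤ → ℝ := fun n => ∑ k ∈ Icc (-(d : ℤ)) d, p k * cosCoeff ε N (n + k) with ha
  obtain ⟨V, hV, haV⟩ := card_abs_correlation_le d N hε p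
  obtain ⟨j, hjK, hj⟩ := exists_gap hδanti hV
  have ha0 : ∀ n : ℤ, N + d < n.natAbs → a n = 0 := by
    intro n hn
    refine sum_eq_zero fun k hk => ?_
    rw [mem_Icc] at hk
    rw [cosCoeff_eq_zero (by omega), mul_zero]
  set S : Finset ℤ := Finset.filter (fun n : ℤ => δ j ≤ |a n|)
    (Icc (-((N : ℤ) + d)) (N + d)) with hS
  have hmemS : ∀ n, n ∈ S ↔ δ j ≤ |a n| := by
    intro n
    rw [hS, mem_filter, mem_Icc, and_iff_right_iff_imp]
    intro h
    by_contra hn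
    rw [ha0 n (by omega), abs_zero] at h
    exact (hδpos j).not_ge h
  refine ⟨S, ?_, ?_⟩
  · refine le_trans ?_ (le_sup (f := fun j => Bf (δ j)) (mem_range.2 (by omega : j < K + 1)))
    refine hcard (δ j) (hδpos j) a S (fun ι hι c n hΦ => hH ι hι c n hΦ)
      (fun m hm => (hmemS m).1 hm) fun m hm => ?_
    rcases hj _ (haV m) with h | h
    · exact absurd ((hmemS m).2 h) hm
    · refine h.trans ?_
      rw [hδs]
      exact min_le_right _ _
  · intro n hn m hm hagree
    rw [hmemS, not_le] at hn hm
    have hdiff : a n - a m = p d * (cosCoeff ε N (n + d) - cosCoeff ε N (m + d)) := by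
      rw [ha]
      simp only
      rw [← sum_sub_distrib, sum_eq_single (d : ℤ)]
      · ring
      · intro k hk hkd
        rw [mem_Icc] at hk
        rw [hagree k hk.1 (by omega), sub_self]
      · intro h
        exact absurd (mem_Icc.2 ⟨by omega, le_rfl⟩) h
    have h1 : |a n - a m| < (1 / 2) ^ d := by
      have h2 : δ j ≤ (1 / 2) ^ (d + 1) := hδ0 ▸ hδanti (Nat.zero_le j)
      have h3 := abs_sub (a n) (a m)
      rw [pow_succ] at h2
      linarith
    rw [hdiff, hp, abs_mul, abs_of_pos (by positivity)] at h1
    exact (mul_lt_iff_lt_one_right (by positivity)).1 h1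

open scoped Nat in
theorem periodic_of_deterministic {T : Type*} [Fintype T] {x : ℕ → T} {s e m : ℕ}
    (h : ∀ i j, s ≤ i → i ≤ e → s ≤ j → j ≤ e → x i = x j → x (i + 1) = x (j + 1))
    (hm : s + Fintype.card T ≤ m) (hme : m + (Fintype.card T)! ≤ e + 1) :
    x (m + (Fintype.card T)!) = x m := by
  obtain ⟨i', j', hij', hxij'⟩ := Fintype.exists_ne_map_eq_of_card_lt
    (fun t : Fin (Fintype.card T + 1) => x (s + t)) (by simp)
  obtain ⟨i, j, hij, hj, hxij⟩ : ∃ i j : ℕ, i < j ∧ j ≤ Fintype.card T ∧ x (s + i) = x (s + j) := by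
    have hi2 := i'.2
    have hj2 := j'.2
    rcases lt_or_gt_of_ne (fun h => hij' (Fin.ext h) : (i' : ℕ) ≠ j') with hlt | hlt
    · exact ⟨i', j', hlt, by omega, hxij'⟩
    · exact ⟨j', i', hlt, by omega, hxij'.symm⟩
  obtain ⟨q, rfl⟩ := Nat.exists_eq_add_of_le hij.le
  have hstep : ∀ k, s + (i + q) + k ≤ e + 1 → x (s + i + k) = x (s + (i + q) + k) := by
    intro k
    induction k with
    | zero => exact fun _ => hxij
    | succ k ih =>
      intro hk
      exact h (s + i + k) (s + (i + q) + k) (by omega) (by omega) (by omega) (by omega)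
        (ih (by omega))
  have hper : ∀ c, m + c * q ≤ e + 1 → x (m + c * q) = x m := by
    intro c
    induction c with
    | zero => simp
    | succ c ih =>
      intro hc
      have h1 : m + (c + 1) * q = m + c * q + q := by ring
      rw [h1] at hc ⊢
      rw [← ih (by omega)]
      have h2 := hstep (m + c * q - (s + i)) (by omega)
      have h3 : s + i + (m + c * q - (s + i)) = m + c * q := by omega
      have h4 : s + (i + q) + (m + c * q - (s + i)) = m + c * q + q := by omega
      rw [h3, h4] at h2
      exact h2.symm
  obtain ⟨c, hc⟩ : q ∣ (Fintype.card T)! := Nat.dvd_factorial (by omega) (by omega)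
  rw [hc, mul_comm] at hme ⊢
  exact hper c hme

open Finset in
open scoped Nat in
theorem exists_almost_period {d : ℕ} (hd0 : 0 < d) : ∃ M B : ℕ, 0 < M ∧ ∀ (N : ℕ) (ε : ℕ → ℝ),
    (∀ n ≤ N, ε n = 1 ∨ ε n = -1) →
    {θ : ℝ | θ ∈ Set.Icc 0 (2 * Real.pi) ∧
      ∑ n ∈ range (N + 1), ε n * Real.cos (n * θ) = 0}.ncard ≤ d →
    #{n ∈ range (N + 1) | n + M ≤ N ∧ ε (n + M) ≠ ε n} ≤ B := by
  classical
  obtain ⟨B, hB⟩ := exists_card_exceptional_le d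
  obtain ⟨W, hW⟩ : ∃ W, W = Fintype.card (Fin (2 * d) → Prop) := ⟨_, rfl⟩
  obtain ⟨M, hM⟩ : ∃ M, M = W ! := ⟨_, rfl⟩
  refine ⟨M, (W + 1) + (M + 2 * d + 1) + B * (M + W + 1), hM ▸ Nat.factorial_pos _,
    fun N ε hε hd => ?_⟩
  obtain ⟨S, hSB, hS⟩ := hB N ε hε hd
  set x : ℕ → Fin (2 * d) → Prop := fun i t => ε (i + t) = 1 with hx
  have heq : ∀ i j, i ≤ N → j ≤ N → ((ε i = 1) = (ε j = 1)) → ε i = ε j := by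
    intro i j hi hj h
    rcases hε i hi with h1 | h1
    · rw [h1, h.mp h1]
    · rcases hε j hj with h2 | h2
      · rw [h2, h.mpr h2]
      · rw [h1, h2]
  have hdet : ∀ i j, 1 ≤ i → 1 ≤ j → i + 2 * d ≤ N → j + 2 * d ≤ N → (i : ℤ) + d ∉ S →
      (j : ℤ) + d ∉ S → x i = x j → x (i + 1) = x (j + 1) := by
    intro i j hi hj hiN hjN hiS hjS hxij
    have hag : ∀ t < 2 * d, ε (i + t) = ε (j + t) := fun t ht =>
      heq _ _ (by omega) (by omega) (congrFun hxij ⟨t, ht⟩)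
    have hcoef : ∀ (i t : ℕ), 1 ≤ i → i + t ≤ N →
        cosCoeff ε N ((i + t : ℕ) : ℤ) = ε (i + t) / 2 := fun i t h1 h2 =>
      cosCoeff_natCast (by omega) h2
    have hlast : ε (i + 2 * d) = ε (j + 2 * d) := by
      have h1 := hS _ hiS _ hjS (fun k hk1 hk2 => by
        obtain ⟨t, ht⟩ : ∃ t : ℕ, k = t - d := ⟨(k + d).toNat, by omega⟩
        have e1 : (i : ℤ) + d + k = ((i + t : ℕ) : ℤ) := by omega
        have e2 : (j : ℤ) + d + k = ((j + t : ℕ) : ℤ) := by omega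
        rw [e1, e2, hcoef i t hi (by omega), hcoef j t hj (by omega), hag t (by omega)])
      have e1 : (i : ℤ) + d + d = ((i + 2 * d : ℕ) : ℤ) := by omega
      have e2 : (j : ℤ) + d + d = ((j + 2 * d : ℕ) : ℤ) := by omega
      rw [e1, e2, hcoef i _ hi hiN, hcoef j _ hj hjN] at h1
      rcases hε _ hiN with h2 | h2 <;> rcases hε _ hjN with h3 | h3 <;> rw [h2, h3] at h1 ⊢
      all_goals norm_num at h1
    funext t
    have hag' : ε (i + 1 + t) = ε (j + 1 + t) := by
      have ht := t.2
      rw [add_assoc, add_assoc]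
      rcases Nat.lt_or_ge (1 + t) (2 * d) with h | h
      · exact hag _ h
      · have : 1 + (t : ℕ) = 2 * d := by omega
        rw [this]
        exact hlast
    simp only [hx, hag']
  have hsub : ({n ∈ range (N + 1) | n + M ≤ N ∧ ε (n + M) ≠ ε n} : Finset ℕ) ⊆
      range (W + 1) ∪ Ico (N + 1 - (M + 2 * d + 1)) (N + 1) ∪
        S.biUnion fun j => (Icc (j - d - M) (j - d + W)).image Int.toNat := by
    intro n hn
    rw [mem_filter, mem_range] at hn
    obtain ⟨hnN, hnM, hne⟩ := hn
    by_contra hnot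
    simp only [mem_union, mem_range, mem_Ico, mem_biUnion, mem_image, mem_Icc, not_or, not_exists,
      not_and, not_lt] at hnot
    obtain ⟨⟨h1, h2⟩, h3⟩ := hnot
    have hgood : ∀ i : ℕ, n - W ≤ i → i ≤ n + M → (i : ℤ) + d ∉ S := fun i hi1 hi2 hiS =>
      h3 _ hiS n ⟨by omega, by omega⟩ (by omega)
    have hper := periodic_of_deterministic (x := x) (s := n - W) (e := n + M) (m := n)
      (fun i j hi1 hi2 hj1 hj2 => hdet i j (by omega) (by omega) (by omega) (by omega)
        (hgood i hi1 hi2) (hgood j hj1 hj2)) (by omega) (by rw [← hW, ← hM]; omega)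
    rw [← hW, ← hM] at hper
    refine hne (heq _ _ hnM (by omega) ?_)
    exact congrFun hper ⟨0, by omega⟩
  refine (card_le_card hsub).trans ((card_union_le _ _).trans (add_le_add
    ((card_union_le _ _).trans (add_le_add ?_ ?_)) ?_))
  · rw [card_range]
  · rw [Nat.card_Ico]
    omega
  · refine (card_biUnion_le_card_mul _ _ (M + W + 1) fun j _ => ?_).trans
      (Nat.mul_le_mul_right _ hSB)
    refine card_image_le.trans ?_
    rw [Int.card_Icc]
    omega

/-- For every positive integer `d` there exists `N₀` such that for every
`N ≥ N₀` and every choice of signs `ε 0, …, ε N ∈ {-1, 1}`, the cosine polynomial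
`f(θ) = Σ_{n=0}^N ε n cos(nθ)` has more than `d` distinct zeros in `[0, 2π]`. -/
theorem stmt1 (d : ℕ) (hd : 0 < d) :
    ∃ N₀ : ℕ, ∀ N : ℕ, N₀ ≤ N →
      ∀ ε : ℕ → ℝ,
        (∀ n ≤ N, ε n = 1 ∨ ε n = -1) →
        d < Set.ncard {θ : ℝ | θ ∈ Set.Icc 0 (2 * Real.pi) ∧
          ∑ n ∈ Finset.range (N + 1), ε n * Real.cos (n * θ) = 0} := by
  obtain ⟨M, B, hM, hB⟩ := exists_almost_period hd
  obtain ⟨N₀, hN₀⟩ := exists_bound_of_almost_periodic (d := d) (M := M) (B := B) hM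
  refine ⟨N₀, fun N hN ε hε => ?_⟩
  by_contra! hle
  have hN0 : ε N ≠ 0 := by rcases hε N le_rfl with h | h <;> simp [h]
  exact (hN₀ N hN ε hε (hB N ε hε hle) (finite_cos_sum_zeros hN0)).not_ge hle
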